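/- Let n ≥ 2. Assume that for each fixed (x,t) the map z ↦ φ(x,t,z) takes at most finitely many values, that each β_ij is a function of x_i and t only, and that for every i and every fixed t the total volatility x ↦ √( ( β_i1(x_i,t)² + … + β_in(x_i,t)² + λ(t)² ∫₀¹ φ_i(x,t,z)² dz ) / x_i² ) is not a nondecreasing function of x_i unless it is constant in x_i. If both A and B are LCP at all points of (0,∞)ⁿ × [0,T], then the coefficients are linear: there exist functions γ_ij : [0,T] → ℝ and γ_i : [0,T] × [0,1] → ℝ such that β_ij(x_i,t) = x_i γ_ij(t) for all i,j, and φ_i(x,t,z) = x_i γ_i(t,z) for almost all z; in particular φ_i does not depend on x_j for j ≠ i. -/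

import Mathlib

open MeasureTheory Set Matrix NNReal

noncomputable section

/-- The open positive orthant `(0,∞)ⁿ` in `ℝⁿ`. -/
def posOrth (n : ℕ) : Set (Fin n → ℝ) := {x | ∀ i, 0 < x i}

/-- First directional derivative of `f` at `x` in direction `v`. -/
def dir1 {n : ℕ} {F : Type*} [NormedAddCommGroup F] [NormedSpace ℝ F]
    (f : (Fin n → ℝ) → F) (x v : Fin n → ℝ) : F :=
  fderiv ℝ f x v

/-- Mixed second derivative: differentiate `f` in direction `v`, then in direction `w`. -/
def dmix {n : ℕ} {F : Type*} [NormedAddCommGroup F] [NormedSpace ℝ F]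
    (f : (Fin n → ℝ) → F) (x v w : Fin n → ℝ) : F :=
  fderiv ℝ (fun y => fderiv ℝ f y v) x w

/-- Second directional derivative of `f` at `x` in direction `v`. -/
def dir2 {n : ℕ} {F : Type*} [NormedAddCommGroup F] [NormedSpace ℝ F]
    (f : (Fin n → ℝ) → F) (x v : Fin n → ℝ) : F :=
  dmix f x v v

/-- The class `F` of test functions: `C⁴` on the positive orthant, with locally Hölder
continuous fourth derivatives, and with `f` together with its derivatives up to order two
of at most polynomial growth. -/
structure MemTestClass (n : ℕ) (f : (Fin n → ℝ) → ℝ) : Prop where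
  smooth : ContDiffOn ℝ 4 f (posOrth n)
  holder4 : ∃ α : ℝ≥0, 0 < α ∧ (α : ℝ) ≤ 1 ∧
    ∀ x ∈ posOrth n, ∃ s ∈ nhds x, s ⊆ posOrth n ∧
      ∃ C : ℝ≥0, HolderOnWith C α (iteratedFDeriv ℝ 4 f) s
  polyGrowth : ∃ C m : ℝ, ∀ x ∈ posOrth n, ∀ k : ℕ, k ≤ 2 →
    ‖iteratedFDeriv ℝ k f x‖ ≤ C * (1 + ‖x‖ ^ m)

/-- The jump structure `φ(x,t,z)` together with the standing assumptions (A3), (A6), (A7). -/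
structure JumpKernel (n : ℕ) (T : ℝ) where
  φ : (Fin n → ℝ) → ℝ → ℝ → (Fin n → ℝ)
  meas : ∀ x ∈ posOrth n, ∀ t ∈ Icc (0:ℝ) T, Measurable (fun z => φ x t z)
  smooth : ∀ t ∈ Icc (0:ℝ) T, ∀ z ∈ Icc (0:ℝ) 1,
    ContDiffOn ℝ 2 (fun x => φ x t z) (posOrth n)
  holder2 : ∃ α : ℝ≥0, 0 < α ∧ (α : ℝ) ≤ 1 ∧
    ∀ t ∈ Icc (0:ℝ) T, ∀ x ∈ posOrth n, ∃ s ∈ nhds x, s ⊆ posOrth n ∧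
      ∃ C : ℝ≥0, ∀ z ∈ Icc (0:ℝ) 1,
        HolderOnWith C α (iteratedFDeriv ℝ 2 (fun y => φ y t z)) s
  bound : ∃ D : ℝ, 0 < D ∧ ∀ x ∈ posOrth n, ∀ t ∈ Icc (0:ℝ) T, ∀ z ∈ Icc (0:ℝ) 1,
    ∀ i, (φ x t z i) ^ 2 ≤ D * (x i) ^ 2
  lower : ∃ γ₀ : ℝ, -1 < γ₀ ∧ ∀ x ∈ posOrth n, ∀ t ∈ Icc (0:ℝ) T, ∀ z ∈ Icc (0:ℝ) 1,
    ∀ i, γ₀ * x i < φ x t z i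

/-- For each fixed `(x,t)`, `φ(x,t,z) ≠ 0` for almost every `z ∈ [0,1]`. -/
def JumpKernel.AENonzero {n : ℕ} {T : ℝ} (K : JumpKernel n T) : Prop :=
  ∀ x ∈ posOrth n, ∀ t ∈ Icc (0:ℝ) T,
    ∀ᵐ z ∂(volume.restrict (Icc (0:ℝ) 1)), K.φ x t z ≠ 0

/-- The jump intensity `λ` : nonnegative and Hölder continuous on `[0,T]`. -/
def LamOK (T : ℝ) (lam : ℝ → ℝ) : Prop :=
  (∀ t ∈ Icc (0:ℝ) T, 0 ≤ lam t) ∧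
  ∃ α C : ℝ≥0, 0 < α ∧ (α : ℝ) ≤ 1 ∧ HolderOnWith C α lam (Icc (0:ℝ) T)

/-- The integro-differential jump operator `B`. -/
def Bop {n : ℕ} {T : ℝ} (lam : ℝ → ℝ) (K : JumpKernel n T)
    (f : (Fin n → ℝ) → ℝ) (x : Fin n → ℝ) (t : ℝ) : ℝ :=
  lam t * ∫ z in Icc (0:ℝ) 1,
    (f (x + K.φ x t z) - f x - fderiv ℝ f x (K.φ x t z))

/-- The diffusion matrix `β(x,t)` together with the standing assumptions (A1), (A3), (A5). -/
structure DiffKernel (n : ℕ) (T : ℝ) where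
  β : (Fin n → ℝ) → ℝ → Matrix (Fin n) (Fin n) ℝ
  smooth : ∀ t ∈ Icc (0:ℝ) T, ∀ i j, ContDiffOn ℝ 2 (fun x => β x t i j) (posOrth n)
  holder2 : ∃ α : ℝ≥0, 0 < α ∧ (α : ℝ) ≤ 1 ∧
    ∀ t ∈ Icc (0:ℝ) T, ∀ i j, ∀ x ∈ posOrth n, ∃ s ∈ nhds x, s ⊆ posOrth n ∧
      ∃ C : ℝ≥0, HolderOnWith C α (iteratedFDeriv ℝ 2 (fun y => β y t i j)) s
  nonsing : ∀ x ∈ posOrth n, ∀ t ∈ Icc (0:ℝ) T, (β x t).det ≠ 0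
  bound : ∃ D : ℝ, 0 < D ∧ ∀ x ∈ posOrth n, ∀ t ∈ Icc (0:ℝ) T,
    ∀ i, ∑ j, (β x t i j) ^ 2 ≤ D * (x i) ^ 2

/-- The second order differential operator `A` with coefficient matrix `a = ββ*/2`. -/
def Aop {n : ℕ} {T : ℝ} (Dk : DiffKernel n T)
    (f : (Fin n → ℝ) → ℝ) (x : Fin n → ℝ) (t : ℝ) : ℝ :=
  ∑ i, ∑ j, ((Dk.β x t * (Dk.β x t)ᵀ) i j / 2) *
    dmix f x (Pi.single i 1) (Pi.single j 1)

/-- An operator `D` (mapping a test function `f` to a function of `(x,t)`) is locally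
convexity preserving (LCP) at `(x,t)` if `∂_v²(Df)(x,t) ≥ 0` for every direction `v ≠ 0`
and every convex `f ∈ F` with `∂_v²f(x) = 0`. -/
def IsLCPAt {n : ℕ} (D : ((Fin n → ℝ) → ℝ) → (Fin n → ℝ) → ℝ → ℝ)
    (x : Fin n → ℝ) (t : ℝ) : Prop :=
  ∀ v : Fin n → ℝ, v ≠ 0 → ∀ f : (Fin n → ℝ) → ℝ,
    MemTestClass n f → ConvexOn ℝ (posOrth n) f → dir2 f x v = 0 →
    0 ≤ dir2 (fun y => D f y t) x v

/-- The integrand in condition (ohly) of Theorem 5.1. -/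
def ohlyIntegrand {n : ℕ} {T : ℝ} (K : JumpKernel n T)
    (f : (Fin n → ℝ) → ℝ) (x v : Fin n → ℝ) (t z : ℝ) : ℝ :=
  dmix f (x + K.φ x t z) v v
    + 2 * dmix f (x + K.φ x t z) v (dir1 (fun y => K.φ y t z) x v)
    + dmix f (x + K.φ x t z) (dir1 (fun y => K.φ y t z) x v)
        (dir1 (fun y => K.φ y t z) x v)
    + (fderiv ℝ f (x + K.φ x t z) (dir2 (fun y => K.φ y t z) x v)
        - fderiv ℝ f x (dir2 (fun y => K.φ y t z) x v))

/-! ### One-variable convexity -/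

/-- If `s ↦ s * U s` is convex near the origin of the half-line and `U` is bounded, then `U` is
nondecreasing. -/
theorem monotoneOn_of_convexOn_id_mul {D : Set ℝ} {U : ℝ → ℝ} {C : ℝ}
    (hconv : ConvexOn ℝ D fun s => s * U s) (hpos : ∀ s ∈ D, 0 < s)
    (hdown : ∀ s ∈ D, ∀ r, 0 < r → r ≤ s → r ∈ D) (hbd : ∀ s ∈ D, |U s| ≤ C) :
    MonotoneOn U D := by
  intro s hs s' hs' hss'
  rcases hss'.eq_or_lt with rfl | hlt
  · exact le_rfl
  have hs0 := hpos s hs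
  have hs'0 := hpos s' hs'
  have key : ∀ᶠ r in nhdsWithin (0:ℝ) (Ioi 0),
      (s' - r) * (s * U s) ≤ (s' - s) * (r * C) + (s - r) * (s' * U s') := by
    filter_upwards [Ioo_mem_nhdsGT hs0] with r hr
    have hrD : r ∈ D := hdown s hs r hr.1 hr.2.le
    have hd : 0 < s' - r := by linarith [hr.2]
    have ha : 0 ≤ (s' - s) / (s' - r) := div_nonneg (by linarith) hd.le
    have hb : 0 ≤ (s - r) / (s' - r) := div_nonneg (by linarith [hr.2]) hd.le
    have h := hconv.2 hrD hs' ha hb (by field_simp; ring)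
    have he : ((s' - s) / (s' - r)) • r + ((s - r) / (s' - r)) • s' = s := by
      simp only [smul_eq_mul]; field_simp; ring
    rw [he] at h
    simp only [smul_eq_mul] at h
    have h2 := mul_le_mul_of_nonneg_left h hd.le
    have h3 : (s' - r) * ((s' - s) / (s' - r) * (r * U r) + (s - r) / (s' - r) * (s' * U s'))
        = (s' - s) * (r * U r) + (s - r) * (s' * U s') := by
      field_simp
    rw [h3] at h2
    have h4 : r * U r ≤ r * C :=
      mul_le_mul_of_nonneg_left ((le_abs_self _).trans (hbd r hrD)) hr.1.le
    have := mul_le_mul_of_nonneg_left h4 (sub_nonneg.2 hss')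
    linarith
  have hlim1 : Filter.Tendsto (fun r : ℝ => (s' - r) * (s * U s)) (nhdsWithin 0 (Ioi 0))
      (nhds ((s' - 0) * (s * U s))) :=
    (Continuous.tendsto (by fun_prop) 0).mono_left nhdsWithin_le_nhds
  have hlim2 : Filter.Tendsto
      (fun r : ℝ => (s' - s) * (r * C) + (s - r) * (s' * U s')) (nhdsWithin 0 (Ioi 0))
      (nhds ((s' - s) * (0 * C) + (s - 0) * (s' * U s'))) :=
    (Continuous.tendsto (by fun_prop) 0).mono_left nhdsWithin_le_nhds
  have h := le_of_tendsto_of_tendsto hlim1 hlim2 key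
  have h' : (s * s') * U s ≤ (s * s') * U s' := by nlinarith
  exact le_of_mul_le_mul_left h' (mul_pos hs0 hs'0)

/-- If `f (s a) + g (s b)` is nondecreasing in `s` for all positive `a`, `b` and `g` is bounded,
then `f` is nondecreasing. -/
theorem monotoneOn_of_add_dilate {f g : ℝ → ℝ} {M : ℝ}
    (hg : ∀ s ∈ Ioi (0:ℝ), |g s| ≤ M)
    (h : ∀ a b : ℝ, 0 < a → 0 < b → MonotoneOn (fun s => f (s * a) + g (s * b)) (Ioi 0)) :
    MonotoneOn f (Ioi 0) := by
  intro s hs s' hs' hss'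
  have hs0 : 0 < s := hs
  have hs'0 : 0 < s' := hs'
  by_contra! hlt
  have hstep : ∀ k : ℕ, g ((s' / s) ^ k) - g ((s' / s) ^ (k + 1)) ≤ f s' - f s := by
    intro k
    have := h 1 ((s' / s) ^ k / s) one_pos (by positivity) hs hs' hss'
    simp only [mul_one] at this
    have e1 : s * ((s' / s) ^ k / s) = (s' / s) ^ k := by field_simp
    have e2 : s' * ((s' / s) ^ k / s) = (s' / s) ^ (k + 1) := by rw [pow_succ]; ring
    rw [e1, e2] at this
    linarith
  have hsum : ∀ N : ℕ, g 1 - g ((s' / s) ^ N) ≤ N * (f s' - f s) := by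
    intro N
    induction N with
    | zero => simp
    | succ k ih => push_cast; linarith [hstep k]
  obtain ⟨N, hN⟩ := exists_nat_gt ((2 * M) / (f s - f s'))
  have hp : 0 < f s - f s' := by linarith
  rw [div_lt_iff₀ hp] at hN
  have h1 := abs_le.1 (hg 1 (mem_Ioi.2 one_pos))
  have h2 := abs_le.1 (hg ((s' / s) ^ N) (mem_Ioi.2 (by positivity)))
  have := hsum N
  nlinarith [h1.1, h2.2]

/-- A continuous function `k` on `ℝ` with `0 ≤ u * k u` for all `u` vanishes at the origin. -/
theorem eq_zero_of_forall_mul_nonneg {k : ℝ → ℝ} (hk : Continuous k) (h : ∀ u, 0 ≤ u * k u) :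
    k 0 = 0 := by
  apply le_antisymm
  · refine le_of_tendsto (hk.continuousWithinAt (s := Iio 0) (x := 0)) ?_
    filter_upwards [self_mem_nhdsWithin] with u hu
    exact nonpos_of_mul_nonneg_right (h u) hu
  · refine ge_of_tendsto (hk.continuousWithinAt (s := Ioi 0) (x := 0)) ?_
    filter_upwards [self_mem_nhdsWithin] with u hu
    exact (mul_nonneg_iff_of_pos_left hu).1 (h u)

/-! ### The orthant and second derivatives along lines -/

theorem isOpen_posOrth (n : ℕ) : IsOpen (posOrth n) := by
  have : posOrth n = ⋂ i, {x | 0 < x i} := by ext; simp [posOrth]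
  rw [this]
  exact isOpen_iInter_of_finite fun i => isOpen_lt continuous_const (continuous_apply i)

theorem posOrth_mem_nhds {n : ℕ} {x : Fin n → ℝ} (hx : x ∈ posOrth n) : posOrth n ∈ nhds x :=
  (isOpen_posOrth n).mem_nhds hx

theorem convex_posOrth (n : ℕ) : Convex ℝ (posOrth n) := by
  have : posOrth n = ⋂ i, (fun x : Fin n → ℝ => x i) ⁻¹' Ioi 0 := by ext; simp [posOrth]
  rw [this]
  exact convex_iInter fun i => (convex_Ioi (0:ℝ)).is_linear_preimage ⟨by simp, by simp⟩

theorem hasDerivAt_line {n : ℕ} (x v : Fin n → ℝ) (s : ℝ) :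
    HasDerivAt (fun s : ℝ => x + s • v) v s := by
  simpa using ((hasDerivAt_id s).smul_const v).const_add x

theorem continuous_line {n : ℕ} (x v : Fin n → ℝ) : Continuous fun s : ℝ => x + s • v := by
  fun_prop

theorem eventually_line_mem {n : ℕ} {x v : Fin n → ℝ} {s : ℝ} {U : Set (Fin n → ℝ)}
    (hU : U ∈ nhds (x + s • v)) : ∀ᶠ s' in nhds s, x + s' • v ∈ U :=
  (continuous_line x v).continuousAt hU

theorem HasFDerivAt.comp_line {n : ℕ} {G : (Fin n → ℝ) → ℝ} {G' : (Fin n → ℝ) →L[ℝ] ℝ}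
    {x v : Fin n → ℝ} {s : ℝ} (h : HasFDerivAt G G' (x + s • v)) :
    HasDerivAt (fun s => G (x + s • v)) (G' v) s :=
  h.comp_hasDerivAt s (hasDerivAt_line x v s)

/-- The derivative of a `C²` function in a fixed direction is differentiable. -/
theorem differentiableAt_fderiv_apply {n : ℕ} {G : (Fin n → ℝ) → ℝ} {x : Fin n → ℝ}
    (h : ContDiffAt ℝ 2 G x) (v : Fin n → ℝ) :
    DifferentiableAt ℝ (fun y => fderiv ℝ G y v) x :=
  ((h.fderiv_right (m := 1) (by norm_num)).differentiableAt one_ne_zero).clm_apply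
    (differentiableAt_const v)

theorem hasDerivAt_line_of_contDiffAt {n : ℕ} {G : (Fin n → ℝ) → ℝ} {x v : Fin n → ℝ} {s : ℝ}
    (h : ContDiffAt ℝ 2 G (x + s • v)) :
    HasDerivAt (fun s => G (x + s • v)) (dir1 G (x + s • v) v) s :=
  (h.differentiableAt two_ne_zero).hasFDerivAt.comp_line

theorem hasDerivAt_dir1_line {n : ℕ} {G : (Fin n → ℝ) → ℝ} {x v : Fin n → ℝ} {s : ℝ}
    (h : ContDiffAt ℝ 2 G (x + s • v)) :
    HasDerivAt (fun s => dir1 G (x + s • v) v) (dir2 G (x + s • v) v) s :=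
  (differentiableAt_fderiv_apply h v).hasFDerivAt.comp_line

/-- The second directional derivative is the second derivative along the line. -/
theorem dir2_eq_deriv2 {n : ℕ} {G : (Fin n → ℝ) → ℝ} {x v : Fin n → ℝ} {s : ℝ}
    (h : ContDiffAt ℝ 2 G (x + s • v)) :
    dir2 G (x + s • v) v = deriv^[2] (fun s => G (x + s • v)) s := by
  have hev : deriv (fun s => G (x + s • v)) =ᶠ[nhds s] fun s => dir1 G (x + s • v) v := by
    filter_upwards [eventually_line_mem (h.eventually (by simp))] with s' hs'
    exact (hasDerivAt_line_of_contDiffAt hs').deriv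
  simp only [Function.iterate_succ, Function.iterate_zero, Function.comp_apply, id]
  rw [hev.deriv_eq, (hasDerivAt_dir1_line h).deriv]

theorem dir2_eq_deriv2_zero {n : ℕ} {G : (Fin n → ℝ) → ℝ} {x v : Fin n → ℝ}
    (h : ContDiffAt ℝ 2 G x) :
    dir2 G x v = deriv^[2] (fun s : ℝ => G (x + s • v)) 0 := by
  have := dir2_eq_deriv2 (G := G) (x := x) (v := v) (s := 0) (by simpa using h)
  simpa using this

/-! ### Membership in the test class -/

theorem memTestClass_of_contDiffOn {n : ℕ} {f : (Fin n → ℝ) → ℝ}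
    {f' : (Fin n → ℝ) → (Fin n → ℝ) →L[ℝ] ℝ}
    {f'' : (Fin n → ℝ) → (Fin n → ℝ) →L[ℝ] (Fin n → ℝ) →L[ℝ] ℝ}
    (hf : ContDiffOn ℝ 5 f (posOrth n))
    (hf' : ∀ x ∈ posOrth n, HasFDerivAt f (f' x) x)
    (hf'' : ∀ x ∈ posOrth n, HasFDerivAt f' (f'' x) x) {C : ℝ}
    (h0 : ∀ x ∈ posOrth n, ‖f x‖ ≤ C * (1 + ‖x‖ ^ 2))
    (h1 : ∀ x ∈ posOrth n, ‖f' x‖ ≤ C * (1 + ‖x‖ ^ 2))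
    (h2 : ∀ x ∈ posOrth n, ‖f'' x‖ ≤ C * (1 + ‖x‖ ^ 2)) : MemTestClass n f where
  smooth := hf.of_le (by norm_num)
  holder4 := by
    refine ⟨1, one_pos, by simp, fun x hx => ?_⟩
    have hc : ContDiffAt ℝ 1 (iteratedFDeriv ℝ 4 f) x :=
      (hf.contDiffAt (posOrth_mem_nhds hx)).iteratedFDeriv_right (by norm_num)
    obtain ⟨K, t, ht, hK⟩ := hc.exists_lipschitzOnWith
    exact ⟨t ∩ posOrth n, Filter.inter_mem ht (posOrth_mem_nhds hx), inter_subset_right, K,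
      holderOnWith_one.2 (hK.mono inter_subset_left)⟩
  polyGrowth := by
    refine ⟨C, 2, fun x hx k hk => ?_⟩
    rw [Real.rpow_two]
    have e1 : fderiv ℝ f =ᶠ[nhds x] f' := by
      filter_upwards [posOrth_mem_nhds hx] with y hy using (hf' y hy).fderiv
    interval_cases k
    · simpa using h0 x hx
    · rw [norm_iteratedFDeriv_one, e1.eq_of_nhds]
      exact h1 x hx
    · rw [← norm_iteratedFDeriv_fderiv, norm_iteratedFDeriv_one, e1.fderiv_eq, (hf'' x hx).fderiv]
      exact h2 x hx

/-! ### Differentiation under the integral sign -/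

/-- A family `y ↦ F y z`, `z ∈ [0,1]`, of `C²` functions on the orthant, measurable in `z`, whose
derivatives up to order two are locally bounded uniformly in `z`. -/
structure LocUnifC2 {n : ℕ} (F : (Fin n → ℝ) → ℝ → ℝ) : Prop where
  smooth : ∀ z ∈ Icc (0:ℝ) 1, ContDiffOn ℝ 2 (fun y => F y z) (posOrth n)
  meas : ∀ y ∈ posOrth n, AEStronglyMeasurable (F y) (volume.restrict (Icc (0:ℝ) 1))
  bound : ∀ x ∈ posOrth n, ∃ U, IsOpen U ∧ x ∈ U ∧ U ⊆ posOrth n ∧ ∃ C : ℝ, ∀ y ∈ U,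
    ∀ z ∈ Icc (0:ℝ) 1, ∀ k ≤ 2, ‖iteratedFDeriv ℝ k (fun y => F y z) y‖ ≤ C

theorem ContinuousLinearMap.eq_sum_smulRight_single {n : ℕ} (A : (Fin n → ℝ) →L[ℝ] ℝ) :
    A = ∑ k, (A (Pi.single k 1)) • (ContinuousLinearMap.proj k : (Fin n → ℝ) →L[ℝ] ℝ) := by
  ext v
  have hv : v = ∑ k, v k • (Pi.single k 1 : Fin n → ℝ) := by
    ext j
    simp [Finset.sum_apply, Pi.single_apply]
  conv_lhs => rw [hv, map_sum]
  simp [mul_comm]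

theorem aestronglyMeasurable_fderiv_param {n : ℕ} {F : (Fin n → ℝ) → ℝ → ℝ}
    {U : Set (Fin n → ℝ)} (hU : IsOpen U)
    (hd : ∀ z ∈ Icc (0:ℝ) 1, DifferentiableOn ℝ (fun y => F y z) U)
    (hm : ∀ y ∈ U, AEStronglyMeasurable (F y) (volume.restrict (Icc (0:ℝ) 1)))
    {x : Fin n → ℝ} (hx : x ∈ U) :
    AEStronglyMeasurable (fun z => fderiv ℝ (fun y => F y z) x)
      (volume.restrict (Icc (0:ℝ) 1)) := by
  have happ : ∀ w : Fin n → ℝ, AEStronglyMeasurable (fun z => fderiv ℝ (fun y => F y z) x w)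
      (volume.restrict (Icc (0:ℝ) 1)) := by
    intro w
    have hmem : ∀ᶠ k : ℕ in Filter.atTop, x + (1 / ((k:ℝ) + 1)) • w ∈ U := by
      have h0 : ∀ᶠ s in nhds (0:ℝ), x + s • w ∈ U :=
        eventually_line_mem (by simpa using hU.mem_nhds hx)
      exact tendsto_one_div_add_atTop_nhds_zero_nat.eventually h0
    obtain ⟨N, hN⟩ := Filter.eventually_atTop.1 hmem
    refine aestronglyMeasurable_of_tendsto_ae Filter.atTop
      (f := fun (k : ℕ) z => (((k + N : ℕ) : ℝ) + 1) *
        (F (x + (1 / (((k + N : ℕ) : ℝ) + 1)) • w) z - F x z)) ?_ ?_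
    · intro k
      exact ((hm _ (hN _ (Nat.le_add_left _ _))).sub (hm x hx)).const_mul _
    · filter_upwards [ae_restrict_mem measurableSet_Icc] with z hz
      have hD : HasDerivAt (fun s : ℝ => F (x + s • w) z) (fderiv ℝ (fun y => F y z) x w) 0 := by
        apply HasFDerivAt.comp_line (G := fun y => F y z)
        simpa using ((hd z hz).differentiableAt (hU.mem_nhds hx)).hasFDerivAt
      have hs := hD.tendsto_slope_zero_right
      have ht : Filter.Tendsto (fun k : ℕ => 1 / (((k + N : ℕ) : ℝ) + 1)) Filter.atTop
          (nhdsWithin 0 (Ioi 0)) := by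
        refine tendsto_nhdsWithin_iff.2 ⟨?_, Filter.Eventually.of_forall fun k => ?_⟩
        · exact (Filter.tendsto_add_atTop_iff_nat (f := fun k : ℕ => 1 / ((k:ℝ) + 1)) N).2
            tendsto_one_div_add_atTop_nhds_zero_nat
        · exact mem_Ioi.2 (by positivity)
      refine (hs.comp ht).congr fun k => ?_
      simp [smul_eq_mul]
  have he : (fun z => fderiv ℝ (fun y => F y z) x) = fun z =>
      ∑ k, (fderiv ℝ (fun y => F y z) x (Pi.single k 1)) •
        (ContinuousLinearMap.proj k : (Fin n → ℝ) →L[ℝ] ℝ) := by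
    ext1 z
    exact ContinuousLinearMap.eq_sum_smulRight_single _
  rw [he]
  exact Finset.aestronglyMeasurable_fun_sum _ fun k _ => (happ _).smul_const _

theorem integrable_Icc_of_bound {E : Type*} [NormedAddCommGroup E] {f : ℝ → E} {C : ℝ}
    (hm : AEStronglyMeasurable f (volume.restrict (Icc (0:ℝ) 1)))
    (hb : ∀ z ∈ Icc (0:ℝ) 1, ‖f z‖ ≤ C) : Integrable f (volume.restrict (Icc (0:ℝ) 1)) :=
  Integrable.of_bound hm C
    ((ae_restrict_mem measurableSet_Icc).mono hb)

theorem hasFDerivAt_integral_Icc {n : ℕ} {F : (Fin n → ℝ) → ℝ → ℝ}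
    {U : Set (Fin n → ℝ)} (hU : IsOpen U) {C : ℝ}
    (hd : ∀ z ∈ Icc (0:ℝ) 1, DifferentiableOn ℝ (fun y => F y z) U)
    (hm : ∀ y ∈ U, AEStronglyMeasurable (F y) (volume.restrict (Icc (0:ℝ) 1)))
    (hb0 : ∀ y ∈ U, ∀ z ∈ Icc (0:ℝ) 1, ‖F y z‖ ≤ C)
    (hb1 : ∀ y ∈ U, ∀ z ∈ Icc (0:ℝ) 1, ‖fderiv ℝ (fun y => F y z) y‖ ≤ C)
    {x : Fin n → ℝ} (hx : x ∈ U) :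
    ∃ L : (Fin n → ℝ) →L[ℝ] ℝ, HasFDerivAt (fun y => ∫ z in Icc (0:ℝ) 1, F y z) L x ∧
      ∀ v, L v = ∫ z in Icc (0:ℝ) 1, fderiv ℝ (fun y => F y z) x v := by
  have hmeas := aestronglyMeasurable_fderiv_param hU hd hm hx
  refine ⟨∫ z in Icc (0:ℝ) 1, fderiv ℝ (fun y => F y z) x, ?_, fun v => ?_⟩
  · refine hasFDerivAt_integral_of_dominated_of_fderiv_le (bound := fun _ => C)
      (F' := fun y z => fderiv ℝ (fun y => F y z) y) (hU.mem_nhds hx) ?_ ?_ hmeas ?_ ?_ ?_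
    · filter_upwards [hU.mem_nhds hx] with y hy using hm y hy
    · exact integrable_Icc_of_bound (hm x hx) (hb0 x hx)
    · filter_upwards [ae_restrict_mem measurableSet_Icc] with z hz y hy using hb1 y hy z hz
    · exact integrable_const C
    · filter_upwards [ae_restrict_mem measurableSet_Icc] with z hz y hy
      exact ((hd z hz).differentiableAt (hU.mem_nhds hy)).hasFDerivAt
  · exact ContinuousLinearMap.integral_apply (integrable_Icc_of_bound hmeas (hb1 x hx)) v

namespace LocUnifC2

variable {n : ℕ} {F : (Fin n → ℝ) → ℝ → ℝ}

theorem contDiffAt (h : LocUnifC2 F) {x : Fin n → ℝ} (hx : x ∈ posOrth n) {z : ℝ}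
    (hz : z ∈ Icc (0:ℝ) 1) : ContDiffAt ℝ 2 (fun y => F y z) x :=
  (h.smooth z hz).contDiffAt (posOrth_mem_nhds hx)

/-- Local bounds for the values, the derivative and the derivative in a fixed direction. -/
theorem exists_bound (h : LocUnifC2 F) {x : Fin n → ℝ} (hx : x ∈ posOrth n) (v : Fin n → ℝ) :
    ∃ U, IsOpen U ∧ x ∈ U ∧ U ⊆ posOrth n ∧ ∃ C : ℝ, ∀ y ∈ U, ∀ z ∈ Icc (0:ℝ) 1,
      ‖F y z‖ ≤ C ∧ ‖fderiv ℝ (fun y => F y z) y‖ ≤ C ∧ ‖dir1 (fun y => F y z) y v‖ ≤ C ∧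
      ‖fderiv ℝ (fun y => dir1 (fun y => F y z) y v) y‖ ≤ C ∧
      ‖dir2 (fun y => F y z) y v‖ ≤ C := by
  obtain ⟨U, hU, hxU, hUs, C, hC⟩ := h.bound x hx
  have hC0 : 0 ≤ C := (norm_nonneg _).trans (hC x hxU 0 (by simp) 0 (by simp))
  refine ⟨U, hU, hxU, hUs, C + C * ‖v‖ + C * ‖v‖ * ‖v‖, fun y hy z hz => ?_⟩
  have h0 := hC y hy z hz 0 (by simp)
  have h1 := hC y hy z hz 1 (by simp)
  have h2 := hC y hy z hz 2 le_rfl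
  rw [norm_iteratedFDeriv_zero] at h0
  rw [norm_iteratedFDeriv_one] at h1
  rw [← norm_iteratedFDeriv_fderiv, norm_iteratedFDeriv_one] at h2
  have hcd := h.contDiffAt (hUs hy) hz
  have hdd : DifferentiableAt ℝ (fderiv ℝ (fun y => F y z)) y :=
    (hcd.fderiv_right (m := 1) (by norm_num)).differentiableAt one_ne_zero
  have hf : fderiv ℝ (fun y => dir1 (fun y => F y z) y v) y
      = (fderiv ℝ (fderiv ℝ (fun y => F y z)) y).flip v := by
    have := hdd.hasFDerivAt.clm_apply (hasFDerivAt_const v y)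
    refine HasFDerivAt.fderiv (f := fun y => dir1 (fun y => F y z) y v) ?_
    simpa [dir1] using this
  have hv := norm_nonneg v
  have hCv := mul_nonneg hC0 hv
  have hCvv := mul_nonneg hCv hv
  have e1 : ‖dir1 (fun y => F y z) y v‖ ≤ C * ‖v‖ :=
    (ContinuousLinearMap.le_opNorm _ _).trans (mul_le_mul_of_nonneg_right h1 hv)
  have e2 : ‖fderiv ℝ (fun y => dir1 (fun y => F y z) y v) y‖ ≤ C * ‖v‖ := by
    rw [hf]
    refine (ContinuousLinearMap.le_opNorm _ _).trans (mul_le_mul_of_nonneg_right ?_ hv)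
    rwa [ContinuousLinearMap.opNorm_flip]
  have e3 : ‖dir2 (fun y => F y z) y v‖ ≤ C * ‖v‖ * ‖v‖ :=
    (ContinuousLinearMap.le_opNorm _ _).trans (mul_le_mul_of_nonneg_right e2 hv)
  refine ⟨?_, ?_, ?_, ?_, ?_⟩ <;> linarith

theorem aestronglyMeasurable_dir1 (h : LocUnifC2 F) {x : Fin n → ℝ} (hx : x ∈ posOrth n)
    (v : Fin n → ℝ) : AEStronglyMeasurable (fun z => dir1 (fun y => F y z) x v)
      (volume.restrict (Icc (0:ℝ) 1)) :=
  (aestronglyMeasurable_fderiv_param (isOpen_posOrth n)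
    (fun z hz => (h.smooth z hz).differentiableOn two_ne_zero) h.meas hx).apply_continuousLinearMap v

theorem differentiableOn_dir1 (h : LocUnifC2 F) (v : Fin n → ℝ) {z : ℝ}
    (hz : z ∈ Icc (0:ℝ) 1) :
    DifferentiableOn ℝ (fun y => dir1 (fun y => F y z) y v) (posOrth n) := fun _ hy =>
  (differentiableAt_fderiv_apply (h.contDiffAt hy hz) v).differentiableWithinAt

theorem aestronglyMeasurable_dir2 (h : LocUnifC2 F) {x : Fin n → ℝ} (hx : x ∈ posOrth n)
    (v : Fin n → ℝ) : AEStronglyMeasurable (fun z => dir2 (fun y => F y z) x v)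
      (volume.restrict (Icc (0:ℝ) 1)) :=
  (aestronglyMeasurable_fderiv_param (F := fun y z => dir1 (fun y => F y z) y v)
    (isOpen_posOrth n) (fun _ hz => h.differentiableOn_dir1 v hz)
    (fun _ hy => h.aestronglyMeasurable_dir1 hy v) hx).apply_continuousLinearMap v

theorem hasFDerivAt_integral (h : LocUnifC2 F) {x : Fin n → ℝ} (hx : x ∈ posOrth n) :
    ∃ L : (Fin n → ℝ) →L[ℝ] ℝ, HasFDerivAt (fun y => ∫ z in Icc (0:ℝ) 1, F y z) L x ∧
      ∀ v, L v = ∫ z in Icc (0:ℝ) 1, dir1 (fun y => F y z) x v := by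
  obtain ⟨U, hU, hxU, hUs, C, hC⟩ := h.exists_bound hx 0
  exact hasFDerivAt_integral_Icc hU
    (fun z hz => ((h.smooth z hz).differentiableOn two_ne_zero).mono hUs)
    (fun y hy => h.meas y (hUs hy)) (fun y hy z hz => (hC y hy z hz).1)
    (fun y hy z hz => (hC y hy z hz).2.1) hxU

theorem hasFDerivAt_integral_dir1 (h : LocUnifC2 F) {x : Fin n → ℝ} (hx : x ∈ posOrth n)
    (v : Fin n → ℝ) :
    ∃ L : (Fin n → ℝ) →L[ℝ] ℝ,
      HasFDerivAt (fun y => ∫ z in Icc (0:ℝ) 1, dir1 (fun y => F y z) y v) L x ∧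
      L v = ∫ z in Icc (0:ℝ) 1, dir2 (fun y => F y z) x v := by
  obtain ⟨U, hU, hxU, hUs, C, hC⟩ := h.exists_bound hx v
  obtain ⟨L, hL, hL'⟩ := hasFDerivAt_integral_Icc
    (F := fun y z => dir1 (fun y => F y z) y v) hU
    (fun z hz => (h.differentiableOn_dir1 v hz).mono hUs)
    (fun y hy => h.aestronglyMeasurable_dir1 (hUs hy) v)
    (fun y hy z hz => (hC y hy z hz).2.2.1)
    (fun y hy z hz => (hC y hy z hz).2.2.2.1) hxU
  exact ⟨L, hL, hL' v⟩

theorem hasDerivAt_integral_line (h : LocUnifC2 F) {x v : Fin n → ℝ} {s : ℝ}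
    (hx : x + s • v ∈ posOrth n) :
    HasDerivAt (fun s : ℝ => ∫ z in Icc (0:ℝ) 1, F (x + s • v) z)
      (∫ z in Icc (0:ℝ) 1, dir1 (fun y => F y z) (x + s • v) v) s := by
  obtain ⟨L, hL, hLv⟩ := h.hasFDerivAt_integral hx
  rw [← hLv v]
  exact hL.comp_line

theorem hasDerivAt_integral_dir1_line (h : LocUnifC2 F) {x v : Fin n → ℝ} {s : ℝ}
    (hx : x + s • v ∈ posOrth n) :
    HasDerivAt (fun s : ℝ => ∫ z in Icc (0:ℝ) 1, dir1 (fun y => F y z) (x + s • v) v)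
      (∫ z in Icc (0:ℝ) 1, dir2 (fun y => F y z) (x + s • v) v) s := by
  obtain ⟨L, hL, hLv⟩ := h.hasFDerivAt_integral_dir1 hx v
  rw [← hLv]
  exact hL.comp_line

theorem dir2_integral (h : LocUnifC2 F) {x : Fin n → ℝ} (hx : x ∈ posOrth n)
    (v : Fin n → ℝ) :
    dir2 (fun y => ∫ z in Icc (0:ℝ) 1, F y z) x v
      = ∫ z in Icc (0:ℝ) 1, dir2 (fun y => F y z) x v := by
  obtain ⟨L, hL, hLv⟩ := h.hasFDerivAt_integral_dir1 hx v
  rw [← hLv, ← hL.fderiv]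
  have : (fun y => fderiv ℝ (fun y => ∫ z in Icc (0:ℝ) 1, F y z) y v) =ᶠ[nhds x]
      fun y => ∫ z in Icc (0:ℝ) 1, dir1 (fun y => F y z) y v := by
    filter_upwards [posOrth_mem_nhds hx] with y hy
    obtain ⟨L, hL, hLv⟩ := h.hasFDerivAt_integral hy
    rw [hL.fderiv, hLv]
  exact congrArg (fun A : (Fin n → ℝ) →L[ℝ] ℝ => A v) this.fderiv_eq

/-- Composition of a locally uniformly `C²` family with a smooth function. -/
theorem comp (h : LocUnifC2 F) {Ψ : (Fin n → ℝ) × ℝ → ℝ} (hΨ : ContDiff ℝ 2 Ψ) :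
    LocUnifC2 fun y z => Ψ (y, F y z) where
  smooth z hz := hΨ.comp_contDiffOn (contDiffOn_id.prodMk (h.smooth z hz))
  meas y hy := (hΨ.continuous.comp (Continuous.prodMk_right y)).comp_aestronglyMeasurable
    (h.meas y hy)
  bound x hx := by
    obtain ⟨U, hU, hxU, hUs, C, hC⟩ := h.bound x hx
    have hcont : Continuous fun p => ∑ i ∈ Finset.range 3, ‖iteratedFDeriv ℝ i Ψ p‖ := by
      refine continuous_finsetSum _ fun i hi => ?_
      have : i ≤ 2 := Nat.lt_succ_iff.1 (Finset.mem_range.1 hi)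
      exact (hΨ.continuous_iteratedFDeriv (by exact_mod_cast this)).norm
    obtain ⟨M, hM⟩ := ((isCompact_closedBall x 1).prod (isCompact_Icc (a := -C) (b := C))
      ).bddAbove_image hcont.continuousOn
    have hcid : Continuous fun p : Fin n → ℝ =>
        ∑ i ∈ Finset.range 3, ‖iteratedFDeriv ℝ i (fun y => y) p‖ :=
      continuous_finsetSum _ fun i _ =>
        (contDiff_id.continuous_iteratedFDeriv (n := (i : ℕ∞)) le_rfl).norm
    obtain ⟨M', hM'⟩ := (isCompact_closedBall x 1).bddAbove_image hcid.continuousOn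
    set D : ℝ := max 1 (max M' C)
    refine ⟨U ∩ Metric.ball x 1, hU.inter Metric.isOpen_ball, ⟨hxU, by simp⟩,
      inter_subset_left.trans hUs, 2 * max M 0 * D ^ 2, fun y hy z hz k hk => ?_⟩
    have hyc : y ∈ Metric.closedBall x 1 := Metric.ball_subset_closedBall hy.2
    have hV := isOpen_posOrth n
    have hyO := hUs hy.1
    have hF := h.contDiffAt hyO hz
    have h0 := hC y hy.1 z hz 0 (by simp)
    rw [norm_iteratedFDeriv_zero, Real.norm_eq_abs, abs_le] at h0
    have hkey := norm_iteratedFDerivWithin_comp_le (g := Ψ) (f := fun y => (y, F y z))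
      (s := posOrth n) (t := univ) (x := y) (n := k) (N := 2) (C := max M 0) (D := D)
      hΨ.contDiffOn (contDiffOn_id.prodMk (h.smooth z hz)) (by exact_mod_cast hk)
      uniqueDiffOn_univ hV.uniqueDiffOn (fun _ _ => mem_univ _) hyO
      (fun i hi => by
        rw [iteratedFDerivWithin_univ]
        refine le_trans ?_ ((hM ⟨(y, F y z), ⟨hyc, h0⟩, rfl⟩).trans (le_max_left _ _))
        exact Finset.single_le_sum (f := fun i => ‖iteratedFDeriv ℝ i Ψ (y, F y z)‖)
          (fun _ _ => norm_nonneg _) (Finset.mem_range.2 (by omega)))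
      (fun i hi hik => by
        rw [iteratedFDerivWithin_of_isOpen _ hV hyO]
        rw [iteratedFDeriv_prodMk (n := 2) (f := fun y => y) contDiffAt_id hF (by exact_mod_cast hik.trans hk),
          ContinuousMultilinearMap.opNorm_prod]
        refine le_trans ?_ (le_self_pow₀ (le_max_left _ _) (by omega))
        refine le_trans (max_le_max ?_ (hC y hy.1 z hz i (hik.trans hk))) (le_max_right _ _)
        refine le_trans ?_ (hM' ⟨y, hyc, rfl⟩)
        exact Finset.single_le_sum (f := fun i => ‖iteratedFDeriv ℝ i (fun y => y) y‖)
          (fun _ _ => norm_nonneg _) (Finset.mem_range.2 (by omega)))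
    rw [iteratedFDerivWithin_of_isOpen _ hV hyO] at hkey
    refine hkey.trans ?_
    have hD1 : 1 ≤ D := le_max_left _ _
    have hf : (k.factorial : ℝ) ≤ 2 := by interval_cases k <;> norm_num [Nat.factorial]
    have hM0 : 0 ≤ max M 0 := le_max_right _ _
    gcongr

end LocUnifC2

/-! ### Local bounds for the jump kernel -/

theorem ContinuousLinearMap.opNorm_le_sum_single {n : ℕ} {G : Type*} [NormedAddCommGroup G]
    [NormedSpace ℝ G] (A : (Fin n → ℝ) →L[ℝ] G) : ‖A‖ ≤ ∑ k, ‖A (Pi.single k 1)‖ := by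
  refine A.opNorm_le_bound (Finset.sum_nonneg fun _ _ => norm_nonneg _) fun v => ?_
  have hv : v = ∑ k, v k • (Pi.single k 1 : Fin n → ℝ) := by
    ext j
    simp [Finset.sum_apply, Pi.single_apply]
  conv_lhs => rw [hv, map_sum]
  rw [Finset.sum_mul]
  refine (norm_sum_le _ _).trans (Finset.sum_le_sum fun k _ => ?_)
  rw [map_smul, norm_smul, mul_comm]
  exact mul_le_mul_of_nonneg_left (norm_le_pi_norm v k) (norm_nonneg _)

theorem second_deriv_mul_sq_le {ψ ψ' ψ'' : ℝ → ℝ} {τ M a : ℝ} (hτ : 0 < τ)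
    (h1 : ∀ s ∈ Ioo (-(2 * τ)) (2 * τ), HasDerivAt ψ (ψ' s) s)
    (h2 : ∀ s ∈ Ioo (-(2 * τ)) (2 * τ), HasDerivAt ψ' (ψ'' s) s)
    (hM : ∀ s ∈ Ioo (-(2 * τ)) (2 * τ), |ψ s| ≤ M)
    (ha : ∀ s ∈ Ioo (-(2 * τ)) (2 * τ), a ≤ ψ'' s) : a * τ ^ 2 ≤ 4 * M := by
  have hD : Convex ℝ (Ioo (-(2 * τ)) (2 * τ)) := convex_Ioo _ _
  have hd1 : ∀ s ∈ Ioo (-(2 * τ)) (2 * τ),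
      HasDerivAt (fun s => ψ s - a * s ^ 2 / 2) (ψ' s - a * s) s := fun s hs => by
    have := (h1 s hs).sub ((((hasDerivAt_id s).pow 2).const_mul a).div_const 2)
    refine this.congr_deriv ?_
    simp
    ring
  have hd2 : ∀ s ∈ Ioo (-(2 * τ)) (2 * τ), HasDerivAt (fun s => ψ' s - a * s) (ψ'' s - a) s :=
    fun s hs => ((h2 s hs).sub ((hasDerivAt_id s).const_mul a)).congr_deriv (by simp)
  have hconv : ConvexOn ℝ (Ioo (-(2 * τ)) (2 * τ)) fun s => ψ s - a * s ^ 2 / 2 := by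
    refine convexOn_of_hasDerivWithinAt2_nonneg hD
      (fun s hs => (hd1 s hs).continuousAt.continuousWithinAt)
      (f' := fun s => ψ' s - a * s) (f'' := fun s => ψ'' s - a) ?_ ?_ ?_
    · exact fun s hs => (hd1 s (interior_subset hs)).hasDerivWithinAt
    · exact fun s hs => (hd2 s (interior_subset hs)).hasDerivWithinAt
    · exact fun s hs => sub_nonneg.2 (ha s (interior_subset hs))
  have m1 : τ ∈ Ioo (-(2 * τ)) (2 * τ) := ⟨by linarith, by linarith⟩
  have m2 : -τ ∈ Ioo (-(2 * τ)) (2 * τ) := ⟨by linarith, by linarith⟩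
  have m0 : (0:ℝ) ∈ Ioo (-(2 * τ)) (2 * τ) := ⟨by linarith, by linarith⟩
  have hh : (0:ℝ) ≤ 1 / 2 := by norm_num
  have h := hconv.2 m1 m2 hh hh (by norm_num)
  simp only [smul_eq_mul] at h
  have e : (1 / 2 * τ + 1 / 2 * -τ : ℝ) = 0 := by ring
  rw [e] at h
  have b1 := abs_le.1 (hM _ m1)
  have b2 := abs_le.1 (hM _ m2)
  have b0 := abs_le.1 (hM _ m0)
  nlinarith [b1.2, b2.2, b0.1]

/-- Bounds for the first two derivatives at the origin in terms of a bound for the function and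
for the oscillation of the second derivative. -/
theorem abs_deriv_le_of_osc {ψ ψ' ψ'' : ℝ → ℝ} {τ M C : ℝ} (hτ : 0 < τ)
    (h1 : ∀ s ∈ Ioo (-(2 * τ)) (2 * τ), HasDerivAt ψ (ψ' s) s)
    (h2 : ∀ s ∈ Ioo (-(2 * τ)) (2 * τ), HasDerivAt ψ' (ψ'' s) s)
    (hM : ∀ s ∈ Ioo (-(2 * τ)) (2 * τ), |ψ s| ≤ M)
    (hC : ∀ s ∈ Ioo (-(2 * τ)) (2 * τ), |ψ'' s - ψ'' 0| ≤ C) :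
    |ψ' 0| ≤ 2 * M / τ + (2 * C + 4 * M / τ ^ 2) * τ ∧ |ψ'' 0| ≤ C + 4 * M / τ ^ 2 := by
  have hτ2 : 0 < τ ^ 2 := by positivity
  have hsec : |ψ'' 0| ≤ C + 4 * M / τ ^ 2 := by
    rw [abs_le]
    have u := second_deriv_mul_sq_le (a := ψ'' 0 - C) hτ h1 h2 hM
      fun s hs => by linarith [(abs_le.1 (hC s hs)).1]
    have l := second_deriv_mul_sq_le (a := -ψ'' 0 - C) hτ (fun s hs => (h1 s hs).neg)
      (fun s hs => (h2 s hs).neg) (fun s hs => by simpa using hM s hs)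
      fun s hs => by linarith [(abs_le.1 (hC s hs)).2]
    rw [← le_div_iff₀ hτ2] at u l
    constructor <;> linarith
  refine ⟨?_, hsec⟩
  have hB : ∀ s ∈ Ioo (-(2 * τ)) (2 * τ), |ψ'' s| ≤ 2 * C + 4 * M / τ ^ 2 := fun s hs => by
    have := abs_sub_abs_le_abs_sub (ψ'' s) (ψ'' 0)
    linarith [hC s hs]
  have hsub : Icc 0 τ ⊆ Ioo (-(2 * τ)) (2 * τ) := fun s hs => ⟨by linarith [hs.1], by linarith [hs.2]⟩
  obtain ⟨ξ, hξ, hξe⟩ := exists_hasDerivAt_eq_slope ψ ψ' hτ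
    (fun s hs => (h1 s (hsub hs)).continuousAt.continuousWithinAt)
    (fun s hs => h1 s (hsub (Ioo_subset_Icc_self hs)))
  have hmv := (convex_Icc 0 τ).norm_image_sub_le_of_norm_hasDerivWithin_le
    (f := ψ') (f' := ψ'') (C := 2 * C + 4 * M / τ ^ 2)
    (fun s hs => (h2 s (hsub hs)).hasDerivWithinAt) (fun s hs => hB s (hsub hs))
    (left_mem_Icc.2 hτ.le) (Ioo_subset_Icc_self hξ)
  rw [Real.norm_eq_abs, Real.norm_eq_abs, sub_zero, abs_of_pos hξ.1] at hmv
  have hB0 : 0 ≤ 2 * C + 4 * M / τ ^ 2 := (abs_nonneg _).trans (hB 0 (hsub (left_mem_Icc.2 hτ.le)))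
  have hmv' : |ψ' ξ - ψ' 0| ≤ (2 * C + 4 * M / τ ^ 2) * τ :=
    hmv.trans (mul_le_mul_of_nonneg_left hξ.2.le hB0)
  have hsl : |ψ' ξ| ≤ 2 * M / τ := by
    rw [hξe, sub_zero, abs_div, abs_of_pos hτ]
    refine div_le_div_of_nonneg_right ?_ hτ.le
    have := abs_sub (ψ τ) (ψ 0)
    linarith [hM τ (hsub (right_mem_Icc.2 hτ.le)), hM 0 (hsub (left_mem_Icc.2 hτ.le))]
  have := abs_sub_abs_le_abs_sub (ψ' 0) (ψ' ξ)
  rw [abs_sub_comm] at this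
  linarith

theorem dir2_eq_fderiv_fderiv {n : ℕ} {G : (Fin n → ℝ) → ℝ} {x : Fin n → ℝ}
    (h : ContDiffAt ℝ 2 G x) (v w : Fin n → ℝ) :
    dmix G x v w = fderiv ℝ (fderiv ℝ G) x w v := by
  have hdd : DifferentiableAt ℝ (fderiv ℝ G) x :=
    (h.fderiv_right (m := 1) (by norm_num)).differentiableAt one_ne_zero
  have := hdd.hasFDerivAt.clm_apply (hasFDerivAt_const v x)
  unfold dmix
  rw [HasFDerivAt.fderiv this]
  simp

/-- A family of `C²` functions, uniformly bounded near `x` and whose second derivatives have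
uniformly bounded oscillation near `x`, has uniformly bounded derivatives near `x`. -/
theorem exists_bound_of_osc {n : ℕ} {F : (Fin n → ℝ) → ℝ → ℝ} {x : Fin n → ℝ} {ρ M C : ℝ}
    (hρ : 0 < ρ) (hρ1 : ρ ≤ 1)
    (hF : ∀ z ∈ Icc (0:ℝ) 1, ∀ y ∈ Metric.ball x ρ, ContDiffAt ℝ 2 (fun y => F y z) y)
    (hM : ∀ z ∈ Icc (0:ℝ) 1, ∀ y ∈ Metric.ball x ρ, |F y z| ≤ M)
    (hC : ∀ z ∈ Icc (0:ℝ) 1, ∀ y ∈ Metric.ball x ρ,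
      ‖iteratedFDeriv ℝ 2 (fun y => F y z) y - iteratedFDeriv ℝ 2 (fun y => F y z) x‖ ≤ C) :
    ∃ B : ℝ, ∀ y ∈ Metric.ball x ρ, ∀ z ∈ Icc (0:ℝ) 1, ∀ k ≤ 2,
      ‖iteratedFDeriv ℝ k (fun y => F y z) y‖ ≤ B := by
  have hx : x ∈ Metric.ball x ρ := Metric.mem_ball_self hρ
  have hdir : ∀ w : Fin n → ℝ, ∃ B : ℝ, ∀ z ∈ Icc (0:ℝ) 1,
      |dir1 (fun y => F y z) x w| ≤ B ∧ |dir2 (fun y => F y z) x w| ≤ B := by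
    intro w
    set τ : ℝ := ρ / (2 * (‖w‖ + 1)) with hτdef
    have hw : 0 < ‖w‖ + 1 := by positivity
    have hτ : 0 < τ := by positivity
    have hmem : ∀ s ∈ Ioo (-(2 * τ)) (2 * τ), x + s • w ∈ Metric.ball x ρ := by
      intro s hs
      rw [Metric.mem_ball, dist_eq_norm, add_sub_cancel_left, norm_smul, Real.norm_eq_abs]
      have h2 : |s| < 2 * τ := abs_lt.2 hs
      have h3 : 2 * τ * (‖w‖ + 1) = ρ := by rw [hτdef]; field_simp
      nlinarith [norm_nonneg w, abs_nonneg s]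
    refine ⟨max (2 * M / τ + (2 * (C * ‖w‖ ^ 2) + 4 * M / τ ^ 2) * τ)
      (C * ‖w‖ ^ 2 + 4 * M / τ ^ 2), fun z hz => ?_⟩
    have := abs_deriv_le_of_osc (C := C * ‖w‖ ^ 2) hτ
      (fun s hs => hasDerivAt_line_of_contDiffAt (v := w) (hF z hz _ (hmem s hs)))
      (fun s hs => hasDerivAt_dir1_line (hF z hz _ (hmem s hs)))
      (fun s hs => hM z hz _ (hmem s hs))
      (fun s hs => by
        have hy := hmem s hs
        have e : ∀ y ∈ Metric.ball x ρ, dir2 (fun y => F y z) y w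
            = iteratedFDeriv ℝ 2 (fun y => F y z) y ![w, w] := fun y hy => by
          rw [iteratedFDeriv_two_apply]
          exact dir2_eq_fderiv_fderiv (hF z hz y hy) w w
        rw [e _ hy, zero_smul, add_zero, e x hx, ← _root_.sub_apply]
        refine (ContinuousMultilinearMap.le_opNorm
          (iteratedFDeriv ℝ 2 (fun y => F y z) (x + s • w) -
            iteratedFDeriv ℝ 2 (fun y => F y z) x) ![w, w]).trans ?_
        rw [Fin.prod_univ_two]
        simp only [Matrix.cons_val_zero, Matrix.cons_val_one]
        rw [← sq]
        exact mul_le_mul_of_nonneg_right (hC z hz _ hy) (sq_nonneg _))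
    simp only [zero_smul, add_zero] at this
    exact ⟨this.1.trans (le_max_left _ _), this.2.trans (le_max_right _ _)⟩
  choose B hB using hdir
  let e : Fin n → Fin n → ℝ := fun k => Pi.single k 1
  set B1 : ℝ := ∑ k, B (e k)
  set B2 : ℝ := ∑ k, ∑ l, (B (e k + e l) + B (e k - e l)) / 4
  have h1x : ∀ z ∈ Icc (0:ℝ) 1, ‖fderiv ℝ (fun y => F y z) x‖ ≤ B1 := fun z hz =>
    (ContinuousLinearMap.opNorm_le_sum_single _).trans
      (Finset.sum_le_sum fun k _ => (hB (e k) z hz).1)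
  have h2x : ∀ z ∈ Icc (0:ℝ) 1, ‖fderiv ℝ (fderiv ℝ (fun y => F y z)) x‖ ≤ B2 := by
    intro z hz
    refine (ContinuousLinearMap.opNorm_le_sum_single _).trans (Finset.sum_le_sum fun k _ => ?_)
    refine (ContinuousLinearMap.opNorm_le_sum_single _).trans (Finset.sum_le_sum fun l _ => ?_)
    have hsymm := ((hF z hz x hx).isSymmSndFDerivAt (by simp)).eq (e k) (e l)
    have p := (hB (e k + e l) z hz).2
    have m := (hB (e k - e l) z hz).2
    rw [dir2, dir2_eq_fderiv_fderiv (hF z hz x hx)] at p m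
    simp only [map_add, map_sub, _root_.add_apply, _root_.sub_apply] at p m
    rw [hsymm] at p m
    rw [Real.norm_eq_abs]
    change |fderiv ℝ (fderiv ℝ fun y => F y z) x (e k) (e l)| ≤ _
    rw [hsymm, abs_le]
    have p' := abs_le.1 p
    have m' := abs_le.1 m
    constructor <;> linarith [p'.1, p'.2, m'.1, m'.2]
  have hI : ∀ z y, ‖iteratedFDeriv ℝ 2 (fun y => F y z) y‖
      = ‖fderiv ℝ (fderiv ℝ (fun y => F y z)) y‖ := fun z y => by
    rw [← norm_iteratedFDeriv_fderiv, norm_iteratedFDeriv_one]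
  have h2y : ∀ z ∈ Icc (0:ℝ) 1, ∀ y ∈ Metric.ball x ρ,
      ‖iteratedFDeriv ℝ 2 (fun y => F y z) y‖ ≤ B2 + C := fun z hz y hy => by
    have := norm_sub_norm_le (iteratedFDeriv ℝ 2 (fun y => F y z) y)
      (iteratedFDeriv ℝ 2 (fun y => F y z) x)
    have h2 := h2x z hz
    rw [← hI] at h2
    linarith [hC z hz y hy]
  have h1y : ∀ z ∈ Icc (0:ℝ) 1, ∀ y ∈ Metric.ball x ρ,
      ‖fderiv ℝ (fun y => F y z) y‖ ≤ B1 + (B2 + C) := fun z hz y hy => by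
    have hmv := (convex_ball x ρ).norm_image_sub_le_of_norm_fderiv_le (𝕜 := ℝ)
      (f := fderiv ℝ (fun y => F y z)) (C := B2 + C)
      (fun w hw => ((hF z hz w hw).fderiv_right (m := 1) (by norm_num)).differentiableAt
        one_ne_zero)
      (fun w hw => (hI z w).symm.trans_le (h2y z hz w hw)) hx hy
    have h0 : 0 ≤ B2 + C := (norm_nonneg _).trans (h2y z hz y hy)
    have hd : ‖y - x‖ ≤ 1 := by
      rw [← dist_eq_norm]
      exact (Metric.mem_ball.1 hy).le.trans hρ1
    have := norm_sub_norm_le (fderiv ℝ (fun y => F y z) y) (fderiv ℝ (fun y => F y z) x)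
    have hle : (B2 + C) * ‖y - x‖ ≤ (B2 + C) := mul_le_of_le_one_right h0 hd
    linarith [h1x z hz]
  refine ⟨max M (max (B1 + (B2 + C)) (B2 + C)), fun y hy z hz k hk => ?_⟩
  interval_cases k
  · rw [norm_iteratedFDeriv_zero]
    exact (hM z hz y hy).trans (le_max_left _ _)
  · rw [norm_iteratedFDeriv_one]
    exact (h1y z hz y hy).trans ((le_max_left _ _).trans (le_max_right _ _))
  · exact (h2y z hz y hy).trans ((le_max_right _ _).trans (le_max_right _ _))

theorem JumpKernel.locUnifC2 {n : ℕ} {T : ℝ} (K : JumpKernel n T) {t : ℝ}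
    (ht : t ∈ Icc (0:ℝ) T) (i : Fin n) : LocUnifC2 fun y z => K.φ y t z i where
  smooth z hz := contDiffOn_pi.1 (K.smooth t ht z hz) i
  meas y hy := ((measurable_pi_apply i).comp (K.meas y hy t ht)).aestronglyMeasurable
  bound x hx := by
    obtain ⟨D, hD, hbd⟩ := K.bound
    obtain ⟨α, hα, -, hhol⟩ := K.holder2
    obtain ⟨s, hs, hsO, C, hC⟩ := hhol t ht x hx
    obtain ⟨r, hr, hrs⟩ := Metric.mem_nhds_iff.1 hs
    set ρ := min r 1
    have hρ : 0 < ρ := lt_min hr one_pos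
    have hρs : Metric.ball x ρ ⊆ s := (Metric.ball_subset_ball (min_le_left _ _)).trans hrs
    have hcd : ∀ z ∈ Icc (0:ℝ) 1, ∀ y ∈ Metric.ball x ρ,
        ContDiffAt ℝ 2 (fun y => K.φ y t z) y := fun z hz y hy =>
      (K.smooth t ht z hz).contDiffAt (posOrth_mem_nhds (hsO (hρs hy)))
    have hx' : x ∈ Metric.ball x ρ := Metric.mem_ball_self hρ
    obtain ⟨B, hB⟩ := exists_bound_of_osc (F := fun y z => K.φ y t z i) (x := x) (ρ := ρ)
      (M := Real.sqrt D * (‖x‖ + 1)) (C := C) hρ (min_le_right _ _)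
      (fun z hz y hy => contDiffAt_pi.1 (hcd z hz y hy) i)
      (fun z hz y hy => by
        have h := hbd y (hsO (hρs hy)) t ht z hz i
        have hy1 : |y i| ≤ ‖x‖ + 1 := by
          have h1 : ‖y i‖ ≤ ‖y‖ := norm_le_pi_norm y i
          have h2 : ‖y - x‖ < ρ := by rw [← dist_eq_norm]; exact hy
          have h3 := norm_sub_norm_le y x
          have h4 : ρ ≤ 1 := min_le_right _ _
          rw [Real.norm_eq_abs] at h1
          linarith
        refine (Real.abs_le_sqrt h).trans ?_
        rw [Real.sqrt_mul hD.le, Real.sqrt_sq_eq_abs]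
        exact mul_le_mul_of_nonneg_left hy1 (Real.sqrt_nonneg _))
      (fun z hz y hy => by
        have e : ∀ y ∈ Metric.ball x ρ, iteratedFDeriv ℝ 2 (fun y => K.φ y t z i) y
            = (ContinuousLinearMap.proj i : (Fin n → ℝ) →L[ℝ] ℝ).compContinuousMultilinearMap
              (iteratedFDeriv ℝ 2 (fun y => K.φ y t z) y) := fun y hy =>
          (ContinuousLinearMap.proj i : (Fin n → ℝ) →L[ℝ] ℝ).iteratedFDeriv_comp_left
            (hcd z hz y hy) le_rfl
        have hle := (hC z hz).dist_le (hρs hy) (hρs hx')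
        have hd : dist y x ^ (α : ℝ) ≤ 1 := Real.rpow_le_one dist_nonneg
          ((Metric.mem_ball.1 hy).le.trans (min_le_right _ _)) α.coe_nonneg
        rw [dist_eq_norm] at hle
        have hle' := hle.trans (mul_le_of_le_one_right C.coe_nonneg hd)
        rw [e y hy, e x hx']
        refine ContinuousMultilinearMap.opNorm_le_bound C.coe_nonneg fun m => ?_
        refine le_trans ?_ (ContinuousMultilinearMap.le_of_opNorm_le hle' m)
        simpa using norm_le_pi_norm ((iteratedFDeriv ℝ 2 (fun y => K.φ y t z) y
          - iteratedFDeriv ℝ 2 (fun y => K.φ y t z) x) m) i)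
    exact ⟨Metric.ball x ρ, Metric.isOpen_ball, hx', hρs.trans hsO, B, hB⟩

/-! ### Test functions of one coordinate and the jump operator -/

theorem deriv2_eq_of_hasDerivAt {g g' : ℝ → ℝ} {g'' s : ℝ}
    (h1 : ∀ᶠ r in nhds s, HasDerivAt g (g' r) r) (h2 : HasDerivAt g' g'' s) :
    deriv^[2] g s = g'' := by
  have hev : deriv g =ᶠ[nhds s] g' := h1.mono fun _ h => h.deriv
  simp only [Function.iterate_succ, Function.iterate_zero, Function.comp_apply, id]
  rw [hev.deriv_eq, h2.deriv]

theorem contDiff_succ_of_hasDerivAt {h h' : ℝ → ℝ} {k : ℕ} (hd : ∀ s, HasDerivAt h (h' s) s)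
    (hc : ContDiff ℝ k h') : ContDiff ℝ (k + 1 : ℕ) h := by
  have e : deriv h = h' := funext fun s => (hd s).deriv
  push_cast
  refine contDiff_succ_iff_deriv.2 ⟨fun s => (hd s).differentiableAt, by simp, e ▸ hc⟩

/-- A convex `C⁵` function on the line with second derivative bounded by one, vanishing to second
order at the origin, together with its first two derivatives. -/
structure UnitConvex (h h' h'' : ℝ → ℝ) : Prop where
  deriv1 : ∀ s, HasDerivAt h (h' s) s
  deriv2 : ∀ s, HasDerivAt h' (h'' s) s
  smooth : ContDiff ℝ 3 h''
  nonneg : ∀ s, 0 ≤ h'' s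
  le_one : ∀ s, h'' s ≤ 1
  zero0 : h 0 = 0
  zero1 : h' 0 = 0
  zero2 : h'' 0 = 0

namespace UnitConvex

variable {h h' h'' : ℝ → ℝ}

theorem smooth' (H : UnitConvex h h' h'') : ContDiff ℝ 4 h' :=
  contDiff_succ_of_hasDerivAt (k := 3) H.deriv2 H.smooth

theorem smooth'' (H : UnitConvex h h' h'') : ContDiff ℝ 5 h :=
  contDiff_succ_of_hasDerivAt (k := 4) H.deriv1 H.smooth'

theorem abs_deriv_le (H : UnitConvex h h' h'') (s : ℝ) : |h' s| ≤ |s| := by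
  have := convex_univ.norm_image_sub_le_of_norm_hasDerivWithin_le (C := 1)
    (fun r _ => (H.deriv2 r).hasDerivWithinAt)
    (fun r _ => by rw [Real.norm_of_nonneg (H.nonneg r)]; exact H.le_one r)
    (mem_univ 0) (mem_univ s)
  simpa [H.zero1] using this

theorem abs_le_sq (H : UnitConvex h h' h'') (s : ℝ) : |h s| ≤ s ^ 2 := by
  have := (convex_Icc (-|s|) |s|).norm_image_sub_le_of_norm_hasDerivWithin_le (C := |s|)
    (fun r _ => (H.deriv1 r).hasDerivWithinAt)
    (fun r hr => (H.abs_deriv_le r).trans (abs_le.2 hr))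
    (abs_le.1 (by simp) : (0:ℝ) ∈ Icc (-|s|) |s|) (abs_le.1 le_rfl : s ∈ Icc (-|s|) |s|)
  simpa [H.zero0, ← sq, sq_abs] using this

theorem convexOn (H : UnitConvex h h' h'') : ConvexOn ℝ univ h :=
  convexOn_of_hasDerivWithinAt2_nonneg convex_univ
    (fun s _ => (H.deriv1 s).continuousAt.continuousWithinAt)
    (fun s _ => (H.deriv1 s).hasDerivWithinAt) (fun s _ => (H.deriv2 s).hasDerivWithinAt)
    fun s _ => H.nonneg s

variable {n : ℕ}

theorem hasFDerivAt_coord (H : UnitConvex h h' h'') (i : Fin n) (c : ℝ) (y : Fin n → ℝ) :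
    HasFDerivAt (fun y : Fin n → ℝ => h (y i - c))
      (h' (y i - c) • (ContinuousLinearMap.proj i : (Fin n → ℝ) →L[ℝ] ℝ)) y :=
  (H.deriv1 (y i - c)).comp_hasFDerivAt y ((hasFDerivAt_apply i y).sub_const c)

theorem memTestClass (H : UnitConvex h h' h'') (i : Fin n) (c : ℝ) :
    MemTestClass n fun y => h (y i - c) := by
  have hle : ∀ y : Fin n → ℝ, |y i - c| ≤ ‖y‖ + |c| := fun y =>
    (abs_sub _ _).trans (add_le_add_left (norm_le_pi_norm y i) _)
  have hp : ‖(ContinuousLinearMap.proj i : (Fin n → ℝ) →L[ℝ] ℝ)‖ ≤ 1 :=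
    ContinuousLinearMap.opNorm_le_bound _ zero_le_one fun y => by
      simpa using norm_le_pi_norm y i
  have hsq : ∀ y : Fin n → ℝ, (1 + |y i - c|) ^ 2 ≤ 3 * (1 + |c|) ^ 2 * (1 + ‖y‖ ^ 2) := by
    intro y
    have h1 := hle y
    have h2 : (1 + |y i - c|) ^ 2 ≤ ((1 + |c|) * (1 + ‖y‖)) ^ 2 := by
      gcongr
      nlinarith [norm_nonneg y, abs_nonneg c, mul_nonneg (norm_nonneg y) (abs_nonneg c)]
    have h3 : (1 + ‖y‖) ^ 2 ≤ 3 * (1 + ‖y‖ ^ 2) := by nlinarith [sq_nonneg (‖y‖ - 1)]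
    calc _ ≤ _ := h2
      _ = (1 + |c|) ^ 2 * (1 + ‖y‖) ^ 2 := by ring
      _ ≤ (1 + |c|) ^ 2 * (3 * (1 + ‖y‖ ^ 2)) := by gcongr
      _ = _ := by ring
  refine memTestClass_of_contDiffOn
    (f' := fun y => h' (y i - c) • (ContinuousLinearMap.proj i : (Fin n → ℝ) →L[ℝ] ℝ))
    (f'' := fun y => (h'' (y i - c) • (ContinuousLinearMap.proj i : (Fin n → ℝ) →L[ℝ] ℝ)).smulRight
      (ContinuousLinearMap.proj i : (Fin n → ℝ) →L[ℝ] ℝ))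
    (C := 3 * (1 + |c|) ^ 2) ?_ (fun y _ => H.hasFDerivAt_coord i c y) (fun y _ => ?_)
    (fun y _ => ?_) (fun y _ => ?_) (fun y _ => ?_)
  · exact (H.smooth''.comp ((contDiff_apply ℝ ℝ i).sub contDiff_const)).contDiffOn
  · have hi : HasFDerivAt (fun y : Fin n → ℝ => y i - c)
        (ContinuousLinearMap.proj i : (Fin n → ℝ) →L[ℝ] ℝ) y :=
      HasFDerivAt.sub_const c (hasFDerivAt_apply i y)
    have hc : HasFDerivAt (fun y : Fin n → ℝ => h' (y i - c))
        (h'' (y i - c) • (ContinuousLinearMap.proj i : (Fin n → ℝ) →L[ℝ] ℝ)) y :=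
      (H.deriv2 (y i - c)).comp_hasFDerivAt y hi
    exact hc.smul_const (ContinuousLinearMap.proj i : (Fin n → ℝ) →L[ℝ] ℝ)
  · refine (H.abs_le_sq _).trans (le_trans ?_ (hsq y))
    nlinarith [abs_nonneg (y i - c), sq_abs (y i - c)]
  · rw [norm_smul]
    refine le_trans ?_ (hsq y)
    have := H.abs_deriv_le (y i - c)
    have h2 := mul_le_of_le_one_right (norm_nonneg (h' (y i - c))) hp
    rw [Real.norm_eq_abs] at h2 ⊢
    nlinarith [abs_nonneg (y i - c)]
  · refine (ContinuousLinearMap.norm_smulRight_apply _ _).trans_le (le_trans ?_ (hsq y))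
    rw [norm_smul, Real.norm_of_nonneg (H.nonneg _)]
    have h1 : h'' (y i - c) * ‖(ContinuousLinearMap.proj i : (Fin n → ℝ) →L[ℝ] ℝ)‖ ≤ 1 :=
      mul_le_one₀ (H.le_one _) (norm_nonneg _) hp
    have := mul_le_one₀ h1 (norm_nonneg _) hp
    nlinarith [abs_nonneg (y i - c)]

theorem convexOn_coord (H : UnitConvex h h' h'') (i : Fin n) (c : ℝ) :
    ConvexOn ℝ (posOrth n) fun y => h (y i - c) := by
  refine ⟨convex_posOrth n, fun x _ y _ a b ha hb hab => ?_⟩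
  have := H.convexOn.2 (mem_univ (x i - c)) (mem_univ (y i - c)) ha hb hab
  refine (le_of_eq ?_).trans this
  refine congrArg h ?_
  simp only [Pi.add_apply, Pi.smul_apply, smul_eq_mul]
  linear_combination c * hab

theorem dir2_coord (H : UnitConvex h h' h'') (i : Fin n) (x v : Fin n → ℝ) :
    dir2 (fun y => h (y i - x i)) x v = 0 := by
  have hc : ContDiff ℝ 2 fun y : Fin n → ℝ => h (y i - x i) :=
    (H.smooth''.of_le (by norm_num)).comp ((contDiff_apply ℝ ℝ i).sub contDiff_const)
  rw [dir2_eq_deriv2_zero hc.contDiffAt]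
  have hl : ∀ s : ℝ, HasDerivAt (fun s : ℝ => s * v i) (v i) s := fun s => by
    simpa using (hasDerivAt_id s).mul_const (v i)
  rw [deriv2_eq_of_hasDerivAt (g' := fun s => h' (s * v i) * v i)
    (g'' := h'' (0 * v i) * v i * v i)]
  · simp [H.zero2]
  · refine .of_forall fun s => ?_
    simpa [Function.comp_def] using! (H.deriv1 (s * v i)).comp s (hl s)
  · exact ((H.deriv2 (0 * v i)).comp 0 (hl 0)).mul_const _

/-- The jump operator applied to a test function of one coordinate. -/
theorem lcp_jump {T : ℝ} {K : JumpKernel n T} {lam : ℝ → ℝ} {t : ℝ} (ht : t ∈ Icc (0:ℝ) T)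
    (hlam : 0 < lam t) {x : Fin n → ℝ} (hx : x ∈ posOrth n) (hB : IsLCPAt (Bop lam K) x t)
    (H : UnitConvex h h' h'') (i : Fin n) (h3 : deriv h'' 0 = 0)
    (hφ : ∀ z ∈ Icc (0:ℝ) 1, h'' (K.φ x t z i) = 0) {v : Fin n → ℝ} (hv : v ≠ 0) :
    0 ≤ ∫ z in Icc (0:ℝ) 1, h' (K.φ x t z i) * dir2 (fun y => K.φ y t z i) x v := by
  have hL := K.locUnifC2 ht i
  set c := x i
  let Ψ : (Fin n → ℝ) × ℝ → ℝ := fun p =>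
    lam t * (h (p.1 i + p.2 - c) - h (p.1 i - c) - h' (p.1 i - c) * p.2)
  have hΨ : ContDiff ℝ 2 Ψ := by
    have hp : ContDiff ℝ 2 fun p : (Fin n → ℝ) × ℝ => p.1 i :=
      (contDiff_apply ℝ ℝ i).comp contDiff_fst
    have hh : ContDiff ℝ 2 h := H.smooth''.of_le (by norm_num)
    have hh' : ContDiff ℝ 2 h' := H.smooth'.of_le (by norm_num)
    exact contDiff_const.mul (((hh.comp ((hp.add contDiff_snd).sub contDiff_const)).sub
      (hh.comp (hp.sub contDiff_const))).sub ((hh'.comp (hp.sub contDiff_const)).mul contDiff_snd))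
  have hpos := hB v hv _ (H.memTestClass i c) (H.convexOn_coord i c) (H.dir2_coord i x v)
  have hBop : (fun y => Bop lam K (fun y => h (y i - c)) y t)
      = fun y => ∫ z in Icc (0:ℝ) 1, Ψ (y, K.φ y t z i) := by
    ext y
    unfold Bop
    rw [← integral_const_mul]
    refine integral_congr_ae (.of_forall fun z => ?_)
    simp only [(H.hasFDerivAt_coord i c y).fderiv, Ψ]
    simp
  rw [hBop, (hL.comp hΨ).dir2_integral hx] at hpos
  have hcalc : ∀ z ∈ Icc (0:ℝ) 1, dir2 (fun y => Ψ (y, K.φ y t z i)) x v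
      = lam t * (h' (K.φ x t z i) * dir2 (fun y => K.φ y t z i) x v) := by
    intro z hz
    have hcd := hL.contDiffAt hx hz
    rw [dir2_eq_deriv2_zero ((hL.comp hΨ).contDiffAt hx hz)]
    set G : (Fin n → ℝ) → ℝ := fun y => K.φ y t z i
    have hl : ∀ s : ℝ, HasDerivAt (fun s : ℝ => s * v i) (v i) s := fun s => by
      simpa using (hasDerivAt_id s).mul_const (v i)
    have hp1 : ∀ᶠ s in nhds (0:ℝ), HasDerivAt (fun s : ℝ => G (x + s • v))
        (dir1 G (x + s • v) v) s := by
      have : ∀ᶠ s in nhds (0:ℝ), x + s • v ∈ posOrth n :=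
        eventually_line_mem (by simpa using posOrth_mem_nhds hx)
      filter_upwards [this] with s hs
      exact hasDerivAt_line_of_contDiffAt (hL.contDiffAt hs hz)
    have hp2 : HasDerivAt (fun s : ℝ => dir1 G (x + s • v) v) (dir2 G x v) 0 := by
      have := hasDerivAt_dir1_line (G := G) (x := x) (v := v) (s := 0) (by simpa using hcd)
      simpa using this
    have e : (fun s : ℝ => Ψ (x + s • v, G (x + s • v))) = fun s =>
        lam t * (h (s * v i + G (x + s • v)) - h (s * v i) - h' (s * v i) * G (x + s • v)) := by
      ext s
      simp only [Ψ, Pi.add_apply, Pi.smul_apply, smul_eq_mul, c]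
      ring_nf
    change deriv^[2] (fun s : ℝ => Ψ (x + s • v, G (x + s • v))) 0 = _
    rw [e]
    have h3' : HasDerivAt h'' 0 0 := by
      have := (H.smooth.differentiable (by norm_num) 0).hasDerivAt
      rwa [h3] at this
    refine deriv2_eq_of_hasDerivAt (g' := fun s => lam t *
      (h' (s * v i + G (x + s • v)) * (v i + dir1 G (x + s • v) v) - h' (s * v i) * v i
        - (h'' (s * v i) * v i * G (x + s • v) + h' (s * v i) * dir1 G (x + s • v) v))) ?_ ?_
    · filter_upwards [hp1] with s hs
      exact ((((H.deriv1 _).comp s ((hl s).add hs)).sub ((H.deriv1 _).comp s (hl s))).sub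
        (((H.deriv2 _).comp s (hl s)).mul hs)).const_mul _
    · have hp10 := hp1.self_of_nhds
      have hx0 : x + (0:ℝ) • v = x := by simp
      have h3'' : HasDerivAt h'' 0 (0 * v i) := by rwa [zero_mul]
      have := ((((((H.deriv2 _).comp 0 ((hl 0).add hp10)).mul (hp2.const_add (v i))).sub
        (((H.deriv2 _).comp 0 (hl 0)).mul_const (v i))).sub
        ((((h3''.comp 0 (hl 0)).mul_const (v i)).mul hp10).add
          (((H.deriv2 _).comp 0 (hl 0)).mul hp2)))).const_mul (lam t)
      refine this.congr_deriv ?_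
      simp only [Function.comp_apply, zero_mul, hx0, H.zero1, H.zero2, zero_add, Pi.add_apply]
      have hφz : h'' (G x) = 0 := hφ z hz
      rw [hφz]
      ring
  rw [setIntegral_congr_fun measurableSet_Icc hcalc, integral_const_mul] at hpos
  exact (mul_nonneg_iff_of_pos_left hlam).1 hpos

end UnitConvex

/-! ### The curvature inequality for the jump sizes -/

/-- A smooth approximation of the indicator function of the complement of the finite set `S`. -/
def cutoff (S : Finset ℝ) (ε s : ℝ) : ℝ := ∏ c ∈ S, (s - c) ^ 2 / ((s - c) ^ 2 + ε)

theorem cutoff_nonneg (S : Finset ℝ) {ε : ℝ} (hε : 0 < ε) (s : ℝ) : 0 ≤ cutoff S ε s :=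
  Finset.prod_nonneg fun _ _ => by positivity

theorem cutoff_le_one (S : Finset ℝ) {ε : ℝ} (hε : 0 < ε) (s : ℝ) : cutoff S ε s ≤ 1 :=
  Finset.prod_le_one (fun _ _ => by positivity)
    fun c _ => div_le_one_of_le₀ (by linarith) (by positivity)

theorem cutoff_eq_zero {S : Finset ℝ} {s : ℝ} (hs : s ∈ S) (ε : ℝ) : cutoff S ε s = 0 :=
  Finset.prod_eq_zero hs (by simp)

theorem contDiff_cutoff (S : Finset ℝ) {ε : ℝ} (hε : 0 < ε) : ContDiff ℝ 3 (cutoff S ε) := by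
  unfold cutoff
  refine contDiff_prod fun c _ => ContDiff.div (by fun_prop) (by fun_prop) fun s => ?_
  positivity

theorem tendsto_cutoff {S : Finset ℝ} {s : ℝ} (hs : s ∉ S) :
    Filter.Tendsto (fun m : ℕ => cutoff S (1 / ((m:ℝ) + 1)) s) Filter.atTop (nhds 1) := by
  have hne : ∀ c ∈ S, (s - c) ^ 2 ≠ 0 := fun c hc =>
    pow_ne_zero 2 (sub_ne_zero.2 fun h => hs (h ▸ hc))
  have h1 : ∏ c ∈ S, (s - c) ^ 2 / ((s - c) ^ 2 + 0) = 1 :=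
    Finset.prod_eq_one fun c hc => by rw [add_zero, div_self (hne c hc)]
  have h2 : Filter.Tendsto (fun m : ℕ => cutoff S (1 / ((m:ℝ) + 1)) s) Filter.atTop
      (nhds (∏ c ∈ S, (s - c) ^ 2 / ((s - c) ^ 2 + 0))) :=
    tendsto_finsetProd _ fun c hc => tendsto_const_nhds.div
      (tendsto_one_div_add_atTop_nhds_zero_nat.const_add _) (by simpa using hne c hc)
  rwa [h1] at h2

theorem hasDerivAt_primitive {f : ℝ → ℝ} (hf : Continuous f) (s : ℝ) :
    HasDerivAt (fun s => ∫ r in (0:ℝ)..s, f r) (f s) s :=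
  intervalIntegral.integral_hasDerivAt_right (hf.intervalIntegrable _ _)
    (hf.stronglyMeasurableAtFilter _ _) hf.continuousAt

theorem unitConvex_cutoff {S : Finset ℝ} (hS : 0 ∈ S) {ε : ℝ} (hε : 0 < ε) :
    UnitConvex (fun s => ∫ r in (0:ℝ)..s, ∫ q in (0:ℝ)..r, cutoff S ε q)
      (fun s => ∫ r in (0:ℝ)..s, cutoff S ε r) (cutoff S ε) where
  deriv1 s := hasDerivAt_primitive (continuous_iff_continuousAt.2 fun r =>
    (hasDerivAt_primitive (contDiff_cutoff S hε).continuous r).continuousAt) s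
  deriv2 s := hasDerivAt_primitive (contDiff_cutoff S hε).continuous s
  smooth := contDiff_cutoff S hε
  nonneg := cutoff_nonneg S hε
  le_one := cutoff_le_one S hε
  zero0 := by simp
  zero1 := by simp
  zero2 := cutoff_eq_zero hS ε

theorem tendsto_primitive_cutoff (S : Finset ℝ) (s : ℝ) :
    Filter.Tendsto (fun m : ℕ => ∫ r in (0:ℝ)..s, cutoff S (1 / ((m:ℝ) + 1)) r) Filter.atTop
      (nhds s) := by
  have h1 : s = ∫ _ in (0:ℝ)..s, (1:ℝ) := by simp
  conv in nhds s => rw [h1]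
  refine intervalIntegral.tendsto_integral_filter_of_dominated_convergence (fun _ => 1)
    (.of_forall fun m => ?_) (.of_forall fun m => .of_forall fun r _ => ?_) (by simp) ?_
  · exact (contDiff_cutoff S (by positivity)).continuous.aestronglyMeasurable
  · rw [Real.norm_of_nonneg (cutoff_nonneg S (by positivity) r)]
    exact cutoff_le_one S (by positivity) r
  · have : (S : Set ℝ)ᶜ ∈ ae volume := compl_mem_ae_iff.2 (S.countable_toSet.measure_zero _)
    filter_upwards [this] with r hr _
    exact tendsto_cutoff (by simpa using hr)

theorem JumpKernel.integral_mul_dir2_nonneg {n : ℕ} {T : ℝ} {K : JumpKernel n T} {lam : ℝ → ℝ}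
    {t : ℝ} (ht : t ∈ Icc (0:ℝ) T) (hlam : 0 < lam t) {x : Fin n → ℝ} (hx : x ∈ posOrth n)
    (hB : IsLCPAt (Bop lam K) x t) (hfin : ((fun z => K.φ x t z) '' Icc (0:ℝ) 1).Finite)
    (i : Fin n) {v : Fin n → ℝ} (hv : v ≠ 0) :
    0 ≤ ∫ z in Icc (0:ℝ) 1, K.φ x t z i * dir2 (fun y => K.φ y t z i) x v := by
  classical
  have hL := K.locUnifC2 ht i
  have hfin' : ((fun z => K.φ x t z i) '' Icc (0:ℝ) 1).Finite := by
    have := hfin.image fun y : Fin n → ℝ => y i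
    rwa [image_image] at this
  set S : Finset ℝ := insert 0 hfin'.toFinset
  have h0S : (0:ℝ) ∈ S := Finset.mem_insert_self _ _
  obtain ⟨U, -, hxU, -, C, hC⟩ := hL.exists_bound hx v
  have hm0 := hL.meas x hx
  have hm2 := hL.aestronglyMeasurable_dir2 hx v
  have hC0 : 0 ≤ C := (norm_nonneg _).trans (hC x hxU 0 (by simp)).1
  refine ge_of_tendsto' (tendsto_integral_of_dominated_convergence (fun _ => C * C)
    (F := fun (m : ℕ) z => (∫ r in (0:ℝ)..K.φ x t z i, cutoff S (1 / ((m:ℝ) + 1)) r)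
      * dir2 (fun y => K.φ y t z i) x v) (fun m => ?_) (integrable_const _) (fun m => ?_) ?_)
    (fun m => ?_)
  · have hε : (0:ℝ) < 1 / ((m:ℝ) + 1) := by positivity
    exact ((unitConvex_cutoff h0S hε).smooth'.continuous.comp_aestronglyMeasurable hm0).mul hm2
  · have hε : (0:ℝ) < 1 / ((m:ℝ) + 1) := by positivity
    filter_upwards [ae_restrict_mem measurableSet_Icc] with z hz
    have h := hC x hxU z hz
    rw [norm_mul]
    exact mul_le_mul (((unitConvex_cutoff h0S hε).abs_deriv_le _).trans h.1) h.2.2.2.2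
      (norm_nonneg _) hC0
  · exact .of_forall fun z => (tendsto_primitive_cutoff S _).mul_const _
  · have hε : (0:ℝ) < 1 / ((m:ℝ) + 1) := by positivity
    have hloc : IsLocalMin (cutoff S (1 / ((m:ℝ) + 1))) 0 := .of_forall fun s => by
      rw [cutoff_eq_zero h0S]
      exact cutoff_nonneg S hε s
    exact (unitConvex_cutoff h0S hε).lcp_jump ht hlam hx hB i hloc.deriv_eq_zero
      (fun z hz => cutoff_eq_zero (Finset.mem_insert_of_mem
        (hfin'.mem_toFinset.2 (mem_image_of_mem _ hz))) _) hv

/-! ### Families with nonnegative integrated curvature -/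

namespace LocUnifC2

variable {n : ℕ} {F : (Fin n → ℝ) → ℝ → ℝ}

theorem integrable (h : LocUnifC2 F) {x : Fin n → ℝ} (hx : x ∈ posOrth n) :
    Integrable (F x) (volume.restrict (Icc (0:ℝ) 1)) := by
  obtain ⟨U, -, hxU, -, C, hC⟩ := h.exists_bound hx 0
  exact integrable_Icc_of_bound (h.meas x hx) fun z hz => (hC x hxU z hz).1

theorem integrable_dir1 (h : LocUnifC2 F) {x : Fin n → ℝ} (hx : x ∈ posOrth n)
    (v : Fin n → ℝ) :
    Integrable (fun z => dir1 (fun y => F y z) x v) (volume.restrict (Icc (0:ℝ) 1)) := by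
  obtain ⟨U, -, hxU, -, C, hC⟩ := h.exists_bound hx v
  exact integrable_Icc_of_bound (h.aestronglyMeasurable_dir1 hx v)
    fun z hz => (hC x hxU z hz).2.2.1

theorem integrable_dir2 (h : LocUnifC2 F) {x : Fin n → ℝ} (hx : x ∈ posOrth n)
    (v : Fin n → ℝ) :
    Integrable (fun z => dir2 (fun y => F y z) x v) (volume.restrict (Icc (0:ℝ) 1)) := by
  obtain ⟨U, -, hxU, -, C, hC⟩ := h.exists_bound hx v
  exact integrable_Icc_of_bound (h.aestronglyMeasurable_dir2 hx v)
    fun z hz => (hC x hxU z hz).2.2.2.2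

theorem integrable_mul_dir2 (h : LocUnifC2 F) {x : Fin n → ℝ} (hx : x ∈ posOrth n)
    (v : Fin n → ℝ) :
    Integrable (fun z => F x z * dir2 (fun y => F y z) x v)
      (volume.restrict (Icc (0:ℝ) 1)) := by
  obtain ⟨U, -, hxU, -, C, hC⟩ := h.exists_bound hx v
  refine integrable_Icc_of_bound (C := C * C) ((h.meas x hx).mul (h.aestronglyMeasurable_dir2 hx v))
    fun z hz => ?_
  rw [norm_mul]
  exact mul_le_mul (hC x hxU z hz).1 (hC x hxU z hz).2.2.2.2 (norm_nonneg _)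
    ((norm_nonneg _).trans (hC x hxU z hz).1)

theorem integrable_sq_dir1 (h : LocUnifC2 F) {x : Fin n → ℝ} (hx : x ∈ posOrth n)
    (v : Fin n → ℝ) (a b : ℝ) :
    Integrable (fun z => (a * dir1 (fun y => F y z) x v - b * F x z) ^ 2)
      (volume.restrict (Icc (0:ℝ) 1)) := by
  obtain ⟨U, -, hxU, -, C, hC⟩ := h.exists_bound hx v
  refine integrable_Icc_of_bound (C := (|a| * C + |b| * C) ^ 2)
    ((((h.aestronglyMeasurable_dir1 hx v).const_mul a).sub ((h.meas x hx).const_mul b)).pow 2)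
    fun z hz => ?_
  rw [norm_pow]
  refine pow_le_pow_left₀ (norm_nonneg _) ((norm_sub_le _ _).trans ?_) 2
  rw [norm_mul, norm_mul]
  exact add_le_add (mul_le_mul_of_nonneg_left (hC x hxU z hz).2.2.1 (abs_nonneg a))
    (mul_le_mul_of_nonneg_left (hC x hxU z hz).1 (abs_nonneg b))

theorem sq (h : LocUnifC2 F) : LocUnifC2 fun y z => F y z ^ 2 :=
  h.comp (Ψ := fun p => p.2 ^ 2) (by fun_prop)

theorem mul_right (h : LocUnifC2 F) {G : ℝ → ℝ} {M : ℝ}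
    (hG : AEStronglyMeasurable G (volume.restrict (Icc (0:ℝ) 1)))
    (hM : ∀ z ∈ Icc (0:ℝ) 1, |G z| ≤ M) : LocUnifC2 fun y z => G z * F y z where
  smooth z hz := contDiffOn_const.mul (h.smooth z hz)
  meas y hy := hG.mul (h.meas y hy)
  bound x hx := by
    obtain ⟨U, hU, hxU, hUs, C, hC⟩ := h.bound x hx
    refine ⟨U, hU, hxU, hUs, M * C, fun y hy z hz k hk => ?_⟩
    have e : iteratedFDeriv ℝ k (fun y => G z * F y z) y
        = G z • iteratedFDeriv ℝ k (fun y => F y z) y :=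
      iteratedFDeriv_const_smul_apply (a := G z) (f := fun y => F y z)
        ((h.contDiffAt (hUs hy) hz).of_le (by exact_mod_cast hk))
    rw [e, norm_smul]
    exact mul_le_mul (hM z hz) (hC y hy z hz k hk) (norm_nonneg _) ((abs_nonneg _).trans (hM z hz))

theorem dir_sq (h : LocUnifC2 F) {x : Fin n → ℝ} (hx : x ∈ posOrth n) (v : Fin n → ℝ) {z : ℝ}
    (hz : z ∈ Icc (0:ℝ) 1) :
    dir1 (fun y => F y z ^ 2) x v = 2 * (F x z * dir1 (fun y => F y z) x v) ∧
    dir2 (fun y => F y z ^ 2) x v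
      = 2 * (dir1 (fun y => F y z) x v ^ 2 + F x z * dir2 (fun y => F y z) x v) := by
  have h1 : ∀ y ∈ posOrth n,
      dir1 (fun y => F y z ^ 2) y v = 2 * (F y z * dir1 (fun y => F y z) y v) := fun y hy => by
    have := ((h.contDiffAt hy hz).differentiableAt two_ne_zero).hasFDerivAt.pow 2
    rw [dir1, this.fderiv]
    simp [dir1]
    ring
  refine ⟨h1 x hx, ?_⟩
  have hev : (fun y => fderiv ℝ (fun y => F y z ^ 2) y v) =ᶠ[nhds x]
      fun y => 2 * (F y z * dir1 (fun y => F y z) y v) := by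
    filter_upwards [posOrth_mem_nhds hx] with y hy using h1 y hy
  have hd1 := ((h.contDiffAt hx hz).differentiableAt two_ne_zero).hasFDerivAt
  have hd2 : HasFDerivAt (fun y => dir1 (fun y => F y z) y v) _ x :=
    (differentiableAt_fderiv_apply (h.contDiffAt hx hz) v).hasFDerivAt
  have hd : HasFDerivAt (fun y => 2 * (F y z * dir1 (fun y => F y z) y v)) _ x :=
    (hd1.mul hd2).const_mul 2
  rw [dir2, dmix, hev.fderiv_eq, hd.fderiv]
  simp [dir1, dir2, dmix]
  ring

theorem curvature_identity (h : LocUnifC2 F) {x : Fin n → ℝ} (hx : x ∈ posOrth n)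
    (v : Fin n → ℝ) (a b : ℝ) :
    a ^ 2 * (∫ z in Icc (0:ℝ) 1, dir2 (fun y => F y z ^ 2) x v)
        - 2 * (a * b) * (∫ z in Icc (0:ℝ) 1, dir1 (fun y => F y z ^ 2) x v)
        + 2 * b ^ 2 * (∫ z in Icc (0:ℝ) 1, F x z ^ 2)
      = 2 * a ^ 2 * (∫ z in Icc (0:ℝ) 1, F x z * dir2 (fun y => F y z) x v)
        + 2 * ∫ z in Icc (0:ℝ) 1, (a * dir1 (fun y => F y z) x v - b * F x z) ^ 2 := by
  simp only [← integral_const_mul]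
  have h12 : Integrable (fun z => a ^ 2 * dir2 (fun y => F y z ^ 2) x v
      - 2 * (a * b) * dir1 (fun y => F y z ^ 2) x v) (volume.restrict (Icc (0:ℝ) 1)) :=
    ((h.sq.integrable_dir2 hx v).const_mul _).sub ((h.sq.integrable_dir1 hx v).const_mul _)
  rw [← integral_sub ((h.sq.integrable_dir2 hx v).const_mul _)
      ((h.sq.integrable_dir1 hx v).const_mul _),
    ← integral_add h12 ((h.sq.integrable hx).const_mul _),
    ← integral_add ((h.integrable_mul_dir2 hx v).const_mul _)
      ((h.integrable_sq_dir1 hx v a b).const_mul _)]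
  refine setIntegral_congr_fun measurableSet_Icc fun z hz => ?_
  simp only [(h.dir_sq hx v hz).1, (h.dir_sq hx v hz).2]
  ring

/-- Along rays issuing from the hyperplane `x i = 0`, the relative second moment is
nondecreasing. -/
theorem monotone_ray (h : LocUnifC2 F)
    (hJ : ∀ x ∈ posOrth n, ∀ v : Fin n → ℝ, v ≠ 0 →
      0 ≤ ∫ z in Icc (0:ℝ) 1, F x z * dir2 (fun y => F y z) x v) {i : Fin n} {D : ℝ}
    (hD : ∀ x ∈ posOrth n, ∀ z ∈ Icc (0:ℝ) 1, F x z ^ 2 ≤ D * x i ^ 2)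
    {b v : Fin n → ℝ} (hb : ∀ k, 0 ≤ b k) (hbi : b i = 0) (hvi : v i = 1) {τ τ' : ℝ}
    (hτ : 0 < τ) (hττ' : τ ≤ τ') (hm : b + τ • v ∈ posOrth n) (hm' : b + τ' • v ∈ posOrth n) :
    (∫ z in Icc (0:ℝ) 1, F (b + τ • v) z ^ 2) / τ ^ 2
      ≤ (∫ z in Icc (0:ℝ) 1, F (b + τ' • v) z ^ 2) / τ' ^ 2 := by
  set E : Set ℝ := {τ | 0 < τ ∧ b + τ • v ∈ posOrth n}
  have hv : v ≠ 0 := fun h0 => by simp [h0] at hvi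
  have hE : Convex ℝ E := by
    refine (convex_Ioi (0:ℝ)).inter fun r hr s hs p q hp hq hpq => ?_
    have := convex_posOrth n hr hs hp hq hpq
    have hq' : q = 1 - p := by linarith
    have e : b + (p • r + q • s) • v = p • (b + r • v) + q • (b + s • v) := by
      rw [hq']
      ext k
      simp
      ring
    change b + (p • r + q • s) • v ∈ posOrth n
    rwa [e]
  set S : ℝ → ℝ := fun s => ∫ z in Icc (0:ℝ) 1, F (b + s • v) z ^ 2
  set S1 : ℝ → ℝ := fun s => ∫ z in Icc (0:ℝ) 1, dir1 (fun y => F y z ^ 2) (b + s • v) v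
  set S2 : ℝ → ℝ := fun s => ∫ z in Icc (0:ℝ) 1, dir2 (fun y => F y z ^ 2) (b + s • v) v
  have hd1 : ∀ s ∈ E, HasDerivAt (fun s => s * (S s / s ^ 2)) (S1 s / s - S s / s ^ 2) s := by
    intro s hs
    have hs0 : s ≠ 0 := hs.1.ne'
    have := (h.sq.hasDerivAt_integral_line hs.2).div (hasDerivAt_id s) hs0
    have hev : (fun s => s * (S s / s ^ 2)) =ᶠ[nhds s] fun s => S s / id s := by
      filter_upwards [isOpen_ne.mem_nhds hs0] with r (hr : r ≠ 0)
      simp only [id]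
      field_simp
    refine (this.congr_of_eventuallyEq hev).congr_deriv ?_
    simp only [id]
    change (S1 s * s - S s * 1) / s ^ 2 = _
    field_simp
  have hd2 : ∀ s ∈ E, HasDerivAt (fun s => S1 s / s - S s / s ^ 2)
      ((s ^ 2 * S2 s - 2 * (s * 1) * S1 s + 2 * 1 ^ 2 * S s) / s ^ 3) s := by
    intro s hs
    have hs0 : s ≠ 0 := hs.1.ne'
    have := ((h.sq.hasDerivAt_integral_dir1_line hs.2).div (hasDerivAt_id s) hs0).sub
      ((h.sq.hasDerivAt_integral_line hs.2).div ((hasDerivAt_id s).pow 2) (by simpa using hs0))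
    refine this.congr_deriv ?_
    simp only [id, Pi.pow_apply]
    change (S2 s * s - S1 s * 1) / s ^ 2 - (S1 s * s ^ 2 - S s * (_)) / (s ^ 2) ^ 2 = _
    field_simp
    push_cast
    ring
  have hnn : ∀ s ∈ E, 0 ≤ (s ^ 2 * S2 s - 2 * (s * 1) * S1 s + 2 * 1 ^ 2 * S s) / s ^ 3 := by
    intro s hs
    have hs0 : 0 < s := hs.1
    refine div_nonneg ?_ (by positivity)
    rw [h.curvature_identity hs.2 v s 1]
    have h1 := hJ _ hs.2 v hv
    have h2 : 0 ≤ ∫ z in Icc (0:ℝ) 1,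
        (s * dir1 (fun y => F y z) (b + s • v) v - 1 * F (b + s • v) z) ^ 2 :=
      integral_nonneg fun _ => sq_nonneg _
    positivity
  have hconv : ConvexOn ℝ E fun s => s * (S s / s ^ 2) :=
    convexOn_of_hasDerivWithinAt2_nonneg hE
      (fun s hs => (hd1 s hs).continuousAt.continuousWithinAt)
      (fun s hs => (hd1 s (interior_subset hs)).hasDerivWithinAt)
      (fun s hs => (hd2 s (interior_subset hs)).hasDerivWithinAt)
      fun s hs => hnn s (interior_subset hs)
  refine monotoneOn_of_convexOn_id_mul (C := D) hconv (fun s hs => hs.1) ?_ ?_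
    ⟨hτ, hm⟩ ⟨hτ.trans_le hττ', hm'⟩ hττ'
  · intro s hs r hr hrs
    refine ⟨hr, fun k => ?_⟩
    have h1 := hs.2 k
    simp only [Pi.add_apply, Pi.smul_apply, smul_eq_mul] at h1 ⊢
    have hs0 : 0 < s := hs.1
    have h2 : s * (b k + r * v k) = (s - r) * b k + r * (b k + s * v k) := by ring
    refine pos_of_mul_pos_right (a := s) ?_ hs0.le
    rw [h2]
    have := mul_nonneg (sub_nonneg.2 hrs) (hb k)
    positivity
  · intro s hs
    have hs0 : 0 < s := hs.1
    have hle : S s ≤ D * s ^ 2 := by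
      have h1 : S s ≤ ∫ _ in Icc (0:ℝ) 1, D * s ^ 2 :=
        setIntegral_mono_on (h.sq.integrable hs.2) (integrable_const _) measurableSet_Icc
          fun z hz => by simpa [hbi, hvi] using hD _ hs.2 z hz
      simpa using h1
    have hS0 : 0 ≤ S s := integral_nonneg fun _ => sq_nonneg _
    rw [abs_of_nonneg (by positivity), div_le_iff₀ (by positivity)]
    exact hle

/-- If moreover the relative second moment does not depend on the `i`-th coordinate, then it is
constant. -/
theorem relMoment_le (h : LocUnifC2 F)
    (hJ : ∀ x ∈ posOrth n, ∀ v : Fin n → ℝ, v ≠ 0 →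
      0 ≤ ∫ z in Icc (0:ℝ) 1, F x z * dir2 (fun y => F y z) x v) {i : Fin n} {D : ℝ}
    (hD : ∀ x ∈ posOrth n, ∀ z ∈ Icc (0:ℝ) 1, F x z ^ 2 ≤ D * x i ^ 2)
    (hconst : ∀ x ∈ posOrth n, ∀ s, 0 < s → (∫ z in Icc (0:ℝ) 1, F (Function.update x i s) z ^ 2)
      / s ^ 2 = (∫ z in Icc (0:ℝ) 1, F x z ^ 2) / x i ^ 2)
    {x y : Fin n → ℝ} (hx : x ∈ posOrth n) (hy : y ∈ posOrth n) :
    (∫ z in Icc (0:ℝ) 1, F x z ^ 2) / x i ^ 2 ≤ (∫ z in Icc (0:ℝ) 1, F y z ^ 2) / y i ^ 2 := by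
  have hupd : ∀ w ∈ posOrth n, ∀ s : ℝ, 0 < s → Function.update w i s ∈ posOrth n := by
    intro w hw s hs k
    rcases eq_or_ne k i with rfl | hk
    · simpa using hs
    · simpa [hk] using hw k
  have hε : ∃ ε : ℝ, 0 < ε ∧ ε < 1 ∧ ∀ k, ε * y k ≤ x k := by
    have : ∀ᶠ ε in nhdsWithin (0:ℝ) (Ioi 0), ∀ k, ε * y k ≤ x k := by
      refine Filter.eventually_all.2 fun k => ?_
      have hc : Filter.Tendsto (fun ε : ℝ => ε * y k) (nhdsWithin 0 (Ioi 0)) (nhds (0 * y k)) :=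
        (Continuous.tendsto (by fun_prop) 0).mono_left nhdsWithin_le_nhds
      exact hc.eventually (Iic_mem_nhds (by simpa using hx k))
    obtain ⟨ε, h1, h2⟩ := (this.and (Ioo_mem_nhdsGT one_pos)).exists
    exact ⟨ε, h2.1, h2.2, h1⟩
  obtain ⟨ε, hε0, hε1, hle⟩ := hε
  have hd : 0 < 1 - ε := by linarith
  set b : Fin n → ℝ := Function.update (fun k => (x k - ε * y k) / (1 - ε)) i 0
  set v : Fin n → ℝ := Function.update (fun k => (y k - x k) / (1 - ε)) i 1
  have e1 : b + ε • v = Function.update x i ε := by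
    ext k
    rcases eq_or_ne k i with rfl | hk
    · simp [b, v]
    · simp [b, v, hk]
      field_simp
      ring
  have e2 : b + (1:ℝ) • v = Function.update y i 1 := by
    ext k
    rcases eq_or_ne k i with rfl | hk
    · simp [b, v]
    · simp [b, v, hk]
      field_simp
      ring
  have := h.monotone_ray hJ hD (b := b) (v := v) (τ := ε) (τ' := 1) (fun k => ?_) (by simp [b])
    (by simp [v]) hε0 hε1.le (e1 ▸ hupd x hx ε hε0) (e2 ▸ hupd y hy 1 one_pos)
  · rwa [e1, e2, hconst x hx ε hε0, hconst y hy 1 one_pos] at this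
  · rcases eq_or_ne k i with rfl | hk
    · simp [b]
    · simp only [b, ne_eq, hk, not_false_eq_true, Function.update_of_ne]
      exact div_nonneg (sub_nonneg.2 (hle k)) hd.le

/-- If the second moment is a constant multiple of the square of the `i`-th coordinate, the family
is almost everywhere proportional to that coordinate. -/
theorem ae_eq_of_sq_integral_eq (h : LocUnifC2 F)
    (hJ : ∀ x ∈ posOrth n, ∀ v : Fin n → ℝ, v ≠ 0 →
      0 ≤ ∫ z in Icc (0:ℝ) 1, F x z * dir2 (fun y => F y z) x v) {i : Fin n} {c : ℝ}
    (hc : ∀ x ∈ posOrth n, ∫ z in Icc (0:ℝ) 1, F x z ^ 2 = c * x i ^ 2)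
    {x y : Fin n → ℝ} (hx : x ∈ posOrth n) (hy : y ∈ posOrth n) :
    ∀ᵐ z ∂(volume.restrict (Icc (0:ℝ) 1)), F y z / y i = F x z / x i := by
  set v := y - x
  rcases eq_or_ne v 0 with hv | hv
  · rw [sub_eq_zero.1 hv]
    exact .of_forall fun _ => rfl
  have hproj : ∀ w : Fin n → ℝ, HasFDerivAt (fun y : Fin n → ℝ => y i)
      (ContinuousLinearMap.proj i : (Fin n → ℝ) →L[ℝ] ℝ) w := fun w => hasFDerivAt_apply i w
  have hzero : ∀ w ∈ posOrth n, ∀ᵐ z ∂(volume.restrict (Icc (0:ℝ) 1)),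
      w i * dir1 (fun y => F y z) w v - v i * F w z = 0 := by
    intro w hw
    have hS1 : ∀ w ∈ posOrth n,
        ∫ z in Icc (0:ℝ) 1, dir1 (fun y => F y z ^ 2) w v = 2 * c * w i * v i := by
      intro w hw
      obtain ⟨L, hL, hLv⟩ := h.sq.hasFDerivAt_integral hw
      rw [← hLv]
      have hev : (fun y => ∫ z in Icc (0:ℝ) 1, F y z ^ 2) =ᶠ[nhds w] fun y => c * y i ^ 2 := by
        filter_upwards [posOrth_mem_nhds hw] with y hy using hc y hy
      rw [(hL.congr_of_eventuallyEq hev.symm).unique (((hproj w).pow 2).const_mul c)]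
      simp
      ring
    have hS2 : ∫ z in Icc (0:ℝ) 1, dir2 (fun y => F y z ^ 2) w v = 2 * c * v i * v i := by
      obtain ⟨L, hL, hLv⟩ := h.sq.hasFDerivAt_integral_dir1 hw v
      rw [← hLv]
      have hev : (fun y => ∫ z in Icc (0:ℝ) 1, dir1 (fun y => F y z ^ 2) y v) =ᶠ[nhds w]
          fun y => 2 * c * y i * v i := by
        filter_upwards [posOrth_mem_nhds hw] with y hy using hS1 y hy
      rw [(hL.congr_of_eventuallyEq hev.symm).unique (((hproj w).const_mul (2 * c)).mul_const (v i))]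
      simp
      ring
    have hid := h.curvature_identity hw v (w i) (v i)
    rw [hS1 w hw, hS2, hc w hw] at hid
    have h1 := mul_nonneg (sq_nonneg (w i)) (hJ w hw v hv)
    have h2 : 0 ≤ ∫ z in Icc (0:ℝ) 1, (w i * dir1 (fun y => F y z) w v - v i * F w z) ^ 2 :=
      integral_nonneg fun _ => sq_nonneg _
    have h3 : ∫ z in Icc (0:ℝ) 1, (w i * dir1 (fun y => F y z) w v - v i * F w z) ^ 2 = 0 := by
      nlinarith
    rw [integral_eq_zero_iff_of_nonneg (fun _ => sq_nonneg _)
      (h.integrable_sq_dir1 hw v _ _)] at h3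
    filter_upwards [h3] with z hz
    simpa using hz
  obtain ⟨U, -, hxU, -, C, hC⟩ := h.exists_bound hx 0
  have hG : LocUnifC2 fun y z => F x z * F y z :=
    h.mul_right (h.meas x hx) fun z hz => (hC x hxU z hz).1
  have hmem : ∀ s ∈ Icc (0:ℝ) 1, x + s • v ∈ posOrth n := fun s hs => by
    have := (convex_posOrth n).add_smul_sub_mem hx hy hs
    exact this
  have hder : ∀ s ∈ Icc (0:ℝ) 1, HasDerivAt
      (fun s : ℝ => (∫ z in Icc (0:ℝ) 1, F x z * F (x + s • v) z) / (x + s • v) i) 0 s := by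
    intro s hs
    have hw := hmem s hs
    have hne : (x + s • v) i ≠ 0 := (hw i).ne'
    refine ((hG.hasDerivAt_integral_line hw).div ((hproj _).comp_line) hne).congr_deriv ?_
    rw [div_eq_zero_iff]
    left
    simp only [ContinuousLinearMap.proj_apply]
    rw [← integral_mul_const, ← integral_mul_const, ← integral_sub
      ((hG.integrable_dir1 hw v).mul_const _) ((hG.integrable hw).mul_const _)]
    refine integral_eq_zero_of_ae ?_
    filter_upwards [hzero _ hw, ae_restrict_mem measurableSet_Icc] with z hz hzI
    have hd := ((h.contDiffAt hw hzI).differentiableAt two_ne_zero).hasFDerivAt.const_mul (F x z)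
    have e : dir1 (fun y => F x z * F y z) (x + s • v) v
        = F x z * dir1 (fun y => F y z) (x + s • v) v := by
      rw [dir1, hd.fderiv]
      rfl
    rw [e, Pi.zero_apply]
    linear_combination F x z * hz
  have hP := constant_of_has_deriv_right_zero
    (fun s hs => (hder s hs).continuousAt.continuousWithinAt)
    (fun s hs => (hder s (Ico_subset_Icc_self hs)).hasDerivWithinAt) 1 (by simp)
  have hxy : x + v = y := by simp [v]
  simp only [one_smul, zero_smul, add_zero, hxy] at hP
  have hxi := (hx i).ne'
  have hyi := (hy i).ne'
  have hxx : ∫ z in Icc (0:ℝ) 1, F x z * F x z = c * x i ^ 2 := by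
    rw [← hc x hx]
    simp only [pow_two]
  rw [hxx] at hP
  have hxy2 : ∫ z in Icc (0:ℝ) 1, F x z * F y z = c * x i * y i := by
    rw [div_eq_iff hyi] at hP
    rw [hP]
    field_simp
  have i1 := ((h.sq.integrable hy).mul_const (x i ^ 2))
  have i2 := ((hG.integrable hy).mul_const (2 * x i * y i))
  have i3 := ((h.sq.integrable hx).mul_const (y i ^ 2))
  have i12 : Integrable (fun z => F y z ^ 2 * x i ^ 2 - F x z * F y z * (2 * x i * y i))
      (volume.restrict (Icc (0:ℝ) 1)) := i1.sub i2
  have i123 : Integrable (fun z => F y z ^ 2 * x i ^ 2 - F x z * F y z * (2 * x i * y i)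
      + F x z ^ 2 * y i ^ 2) (volume.restrict (Icc (0:ℝ) 1)) := i12.add i3
  have hint : ∫ z in Icc (0:ℝ) 1, (F y z ^ 2 * x i ^ 2 - F x z * F y z * (2 * x i * y i)
      + F x z ^ 2 * y i ^ 2) = 0 := by
    rw [integral_add i12 i3, integral_sub i1 i2, integral_mul_const, integral_mul_const,
      integral_mul_const, hxy2, hc x hx, hc y hy]
    ring
  have hsq : ∀ z, F y z ^ 2 * x i ^ 2 - F x z * F y z * (2 * x i * y i) + F x z ^ 2 * y i ^ 2
      = (F y z * x i - F x z * y i) ^ 2 := fun z => by ring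
  rw [integral_eq_zero_iff_of_nonneg (fun z => by
    rw [Pi.zero_apply, hsq]; exact sq_nonneg _) i123] at hint
  filter_upwards [hint] with z hz
  rw [hsq, Pi.zero_apply, sq_eq_zero_iff, sub_eq_zero] at hz
  rw [div_eq_div_iff hyi hxi, hz]

end LocUnifC2

/-! ### Quadratic-over-linear test functions and the diffusion operator -/

/-- The data of a quotient `p(y - x)² / (e(y) + c)` of the square of an affine function by a
positive affine function. -/
structure QuadOverLin (n : ℕ) where
  p : (Fin n → ℝ) →L[ℝ] ℝ
  e : (Fin n → ℝ) →L[ℝ] ℝ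
  x : Fin n → ℝ
  c : ℝ
  c_pos : 0 < c
  e_nonneg : ∀ y ∈ posOrth n, 0 ≤ e y

namespace QuadOverLin

variable {n : ℕ} (q : QuadOverLin n)

/-- The denominator. -/
def den (y : Fin n → ℝ) : ℝ := q.e y + q.c

/-- The quotient of the affine functions. -/
def ratio (y : Fin n → ℝ) : ℝ := q.p (y - q.x) / q.den y

/-- The quadratic-over-linear function. -/
def toFun (y : Fin n → ℝ) : ℝ := q.p (y - q.x) * q.ratio y

/-- The linear form whose square is, up to a factor, the second derivative. -/
def form (y : Fin n → ℝ) : (Fin n → ℝ) →L[ℝ] ℝ := q.p - q.ratio y • q.e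

theorem le_den {y : Fin n → ℝ} (hy : y ∈ posOrth n) : q.c ≤ q.den y :=
  le_add_of_nonneg_left (q.e_nonneg y hy)

theorem den_pos {y : Fin n → ℝ} (hy : y ∈ posOrth n) : 0 < q.den y :=
  q.c_pos.trans_le (q.le_den hy)

theorem hasFDerivAt_num (y : Fin n → ℝ) : HasFDerivAt (fun y => q.p (y - q.x)) q.p y := by
  have h : HasFDerivAt (fun y => y - q.x) (ContinuousLinearMap.id ℝ (Fin n → ℝ)) y :=
    (hasFDerivAt_id y).sub_const q.x
  exact q.p.hasFDerivAt.comp y h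

theorem hasFDerivAt_ratio {y : Fin n → ℝ} (hy : y ∈ posOrth n) :
    HasFDerivAt q.ratio ((q.den y)⁻¹ • q.form y) y := by
  have hd : HasFDerivAt q.den q.e y := q.e.hasFDerivAt.add_const q.c
  have hne := (q.den_pos hy).ne'
  have hi : HasFDerivAt (fun y => (q.den y)⁻¹) (-(q.den y ^ 2)⁻¹ • q.e) y :=
    (hasDerivAt_inv hne).comp_hasFDerivAt y hd
  have := (q.hasFDerivAt_num y).mul hi
  refine (this.congr_fderiv ?_).congr_of_eventuallyEq (.of_forall fun y => div_eq_mul_inv _ _)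
  ext w
  simp [form, ratio]
  field_simp
  ring

theorem hasFDerivAt_toFun {y : Fin n → ℝ} (hy : y ∈ posOrth n) :
    HasFDerivAt q.toFun (q.ratio y • ((2:ℝ) • q.p - q.ratio y • q.e)) y := by
  have hne := (q.den_pos hy).ne'
  refine ((q.hasFDerivAt_num y).mul (q.hasFDerivAt_ratio hy)).congr_fderiv ?_
  ext w
  simp [form, ratio]
  field_simp
  ring

theorem hasFDerivAt_fderiv {y : Fin n → ℝ} (hy : y ∈ posOrth n) :
    HasFDerivAt (fun y => q.ratio y • ((2:ℝ) • q.p - q.ratio y • q.e))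
      (((2 * (q.den y)⁻¹) • q.form y).smulRight (q.form y)) y := by
  have hr := q.hasFDerivAt_ratio hy
  have h1 : HasFDerivAt (fun y => (2:ℝ) • q.p - q.ratio y • q.e)
      (-(((q.den y)⁻¹ • q.form y).smulRight q.e)) y :=
    (hr.smul_const q.e).const_sub _
  refine (hr.smul h1).congr_fderiv ?_
  ext v w
  simp [form]
  ring

theorem contDiffOn_ratio : ContDiffOn ℝ 5 q.ratio (posOrth n) :=
  ContDiffOn.div (q.p.contDiff.comp (contDiff_id.sub contDiff_const)).contDiffOn
    (q.e.contDiff.add contDiff_const).contDiffOn fun _ hy => (q.den_pos hy).ne'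

theorem contDiffOn_toFun : ContDiffOn ℝ 5 q.toFun (posOrth n) :=
  (q.p.contDiff.comp (contDiff_id.sub contDiff_const)).contDiffOn.mul q.contDiffOn_ratio

theorem dmix_toFun {y : Fin n → ℝ} (hy : y ∈ posOrth n) (v w : Fin n → ℝ) :
    dmix q.toFun y v w = 2 * (q.den y)⁻¹ * q.form y v * q.form y w := by
  have hev : fderiv ℝ q.toFun =ᶠ[nhds y] fun y => q.ratio y • ((2:ℝ) • q.p - q.ratio y • q.e) := by
    filter_upwards [posOrth_mem_nhds hy] with y hy using (q.hasFDerivAt_toFun hy).fderiv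
  rw [dir2_eq_fderiv_fderiv
    ((q.contDiffOn_toFun.contDiffAt (posOrth_mem_nhds hy)).of_le (by norm_num)), hev.fderiv_eq,
    (q.hasFDerivAt_fderiv hy).fderiv]
  simp
  ring

theorem memTestClass : MemTestClass n q.toFun := by
  have hc := q.c_pos
  set A : ℝ := 1 + ‖q.p‖ * (1 + ‖q.x‖) + ‖q.e‖
  have hA1 : 1 ≤ A := by
    have : 0 ≤ ‖q.p‖ * (1 + ‖q.x‖) := by positivity
    have := norm_nonneg q.e
    linarith
  have hpA : ‖q.p‖ ≤ A := by
    have : 0 ≤ ‖q.p‖ * ‖q.x‖ := by positivity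
    have := norm_nonneg q.e
    linarith
  have heA : ‖q.e‖ ≤ A := by
    have : 0 ≤ ‖q.p‖ * (1 + ‖q.x‖) := by positivity
    linarith
  have hnum : ∀ y, |q.p (y - q.x)| ≤ A * (1 + ‖y‖) := fun y => by
    have h1 := q.p.le_opNorm (y - q.x)
    have h2 := norm_sub_le y q.x
    calc _ ≤ ‖q.p‖ * ‖y - q.x‖ := h1
      _ ≤ ‖q.p‖ * ((1 + ‖q.x‖) * (1 + ‖y‖)) := by
        gcongr
        nlinarith [norm_nonneg y, norm_nonneg q.x, mul_nonneg (norm_nonneg q.x) (norm_nonneg y)]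
      _ = (‖q.p‖ * (1 + ‖q.x‖)) * (1 + ‖y‖) := by ring
      _ ≤ A * (1 + ‖y‖) := by
        gcongr
        have := norm_nonneg q.e
        linarith
  set c' : ℝ := 1 + q.c⁻¹
  have hc' : 1 ≤ c' := le_add_of_nonneg_right (by positivity)
  have hdi : ∀ y ∈ posOrth n, (q.den y)⁻¹ ≤ c' := fun y hy =>
    (inv_anti₀ hc (q.le_den hy)).trans (le_add_of_nonneg_left zero_le_one)
  have hr : ∀ y ∈ posOrth n, |q.ratio y| ≤ A * c' * (1 + ‖y‖) := fun y hy => by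
    rw [ratio, div_eq_mul_inv, abs_mul, abs_of_pos (inv_pos.2 (q.den_pos hy))]
    calc _ ≤ A * (1 + ‖y‖) * c' := by
          have := hnum y
          have := hdi y hy
          have := (inv_pos.2 (q.den_pos hy)).le
          gcongr
      _ = _ := by ring
  have hre : ∀ y ∈ posOrth n, ‖q.ratio y • q.e‖ ≤ A ^ 2 * c' * (1 + ‖y‖) := fun y hy => by
    rw [norm_smul, Real.norm_eq_abs]
    calc _ ≤ A * c' * (1 + ‖y‖) * A := by
          have := hr y hy
          gcongr
      _ = _ := by ring
  have hp2 : ∀ y : Fin n → ℝ, ‖q.p‖ ≤ A ^ 2 * c' * (1 + ‖y‖) := fun y => by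
    have h1 : A ≤ A ^ 2 := by nlinarith
    have h2 : A ^ 2 * 1 * 1 ≤ A ^ 2 * c' * (1 + ‖y‖) := by
      gcongr
      linarith [norm_nonneg y]
    linarith
  set M : ℝ := A ^ 2 * c'
  have hM1 : 1 ≤ M := by
    have : (1:ℝ) ≤ A ^ 2 := one_le_pow₀ hA1
    exact one_le_mul_of_one_le_of_one_le this hc'
  have hAM : A ≤ M := by
    have h1 : A ≤ A ^ 2 := by nlinarith
    exact h1.trans (le_mul_of_one_le_right (by positivity) hc')
  have hAM' : A * c' ≤ M := by
    have h1 : A ≤ A ^ 2 := by nlinarith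
    exact mul_le_mul_of_nonneg_right h1 (by linarith)
  have hcM : c' ≤ M := le_mul_of_one_le_left (by linarith) (one_le_pow₀ hA1)
  have hsq : ∀ y : Fin n → ℝ, (1 + ‖y‖) ^ 2 ≤ 2 * (1 + ‖y‖ ^ 2) := fun y => by
    nlinarith [sq_nonneg (‖y‖ - 1)]
  have hfin : ∀ (y : Fin n → ℝ) (r : ℝ), r ≤ 8 * M ^ 3 * (1 + ‖y‖) ^ 2 →
      r ≤ 16 * M ^ 3 * (1 + ‖y‖ ^ 2) := fun y r h => by
    calc r ≤ 8 * M ^ 3 * (1 + ‖y‖) ^ 2 := h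
      _ ≤ 8 * M ^ 3 * (2 * (1 + ‖y‖ ^ 2)) := by
        have := hsq y
        gcongr
      _ = _ := by ring
  have hM23 : M ^ 2 ≤ M ^ 3 := pow_le_pow_right₀ hM1 (by norm_num)
  refine memTestClass_of_contDiffOn (C := 16 * M ^ 3) q.contDiffOn_toFun
    (fun y hy => q.hasFDerivAt_toFun hy) (fun y hy => q.hasFDerivAt_fderiv hy)
    (fun y hy => hfin y _ ?_) (fun y hy => hfin y _ ?_) (fun y hy => hfin y _ ?_)
  · rw [toFun, norm_mul, Real.norm_eq_abs, Real.norm_eq_abs]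
    calc _ ≤ (M * (1 + ‖y‖)) * (M * (1 + ‖y‖)) := by
          refine mul_le_mul ((hnum y).trans ?_) ((hr y hy).trans ?_) (abs_nonneg _)
            (by positivity) <;> gcongr
      _ = 1 * M ^ 2 * (1 + ‖y‖) ^ 2 := by ring
      _ ≤ 8 * M ^ 3 * (1 + ‖y‖) ^ 2 := by gcongr; norm_num
  · rw [norm_smul, Real.norm_eq_abs]
    calc _ ≤ (M * (1 + ‖y‖)) * (2 * (M * (1 + ‖y‖)) + M * (1 + ‖y‖)) := by
          refine mul_le_mul ((hr y hy).trans (by gcongr)) ((norm_sub_le _ _).trans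
            (add_le_add ?_ (hre y hy))) (norm_nonneg _) (by positivity)
          rw [norm_smul, Real.norm_of_nonneg zero_le_two]
          exact mul_le_mul_of_nonneg_left (hp2 y) zero_le_two
      _ = 3 * M ^ 2 * (1 + ‖y‖) ^ 2 := by ring
      _ ≤ 8 * M ^ 3 * (1 + ‖y‖) ^ 2 := by gcongr; norm_num
  · have hw : ‖q.form y‖ ≤ 2 * (M * (1 + ‖y‖)) :=
      (norm_sub_le _ _).trans (by linarith [hp2 y, hre y hy])
    rw [ContinuousLinearMap.norm_smulRight_apply, norm_smul,
      Real.norm_of_nonneg (mul_nonneg zero_le_two (inv_pos.2 (q.den_pos hy)).le)]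
    calc _ ≤ (2 * M) * (2 * (M * (1 + ‖y‖))) * (2 * (M * (1 + ‖y‖))) := by
          have := (hdi y hy).trans hcM
          have := (inv_pos.2 (q.den_pos hy)).le
          gcongr
      _ = 8 * M ^ 3 * (1 + ‖y‖) ^ 2 := by ring

theorem convexOn : ConvexOn ℝ (posOrth n) q.toFun := by
  refine ⟨convex_posOrth n, fun y hy z hz a b ha hb hab => ?_⟩
  have hyz := convex_posOrth n hy hz ha hb hab
  have hd : q.den (a • y + b • z) = a * q.den y + b * q.den z := by
    simp only [den, map_add, map_smul, smul_eq_mul]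
    linear_combination (-q.c) * hab
  have hn : q.p (a • y + b • z - q.x) = a * q.p (y - q.x) + b * q.p (z - q.x) := by
    simp only [map_sub, map_add, map_smul, smul_eq_mul]
    linear_combination (q.p q.x) * hab
  have hP : ∀ w ∈ posOrth n, q.p (w - q.x) = q.ratio w * q.den w := fun w hw => by
    rw [ratio, div_mul_cancel₀ _ (q.den_pos hw).ne']
  have hdy := q.den_pos hy
  have hdz := q.den_pos hz
  have h0 := q.den_pos hyz
  rw [toFun, ratio, ← mul_div_assoc, div_le_iff₀ h0, hn, hd, toFun, toFun, hP y hy, hP z hz]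
  simp only [smul_eq_mul]
  have : 0 ≤ a * b * (q.den y * q.den z) * (q.ratio y - q.ratio z) ^ 2 := by positivity
  nlinarith

theorem form_of_num_eq_zero {y : Fin n → ℝ} (h : q.p (y - q.x) = 0) : q.form y = q.p := by
  simp [form, ratio, h]

theorem Aop_toFun {T : ℝ} (Dk : DiffKernel n T) {y : Fin n → ℝ} (hy : y ∈ posOrth n) (t : ℝ) :
    Aop Dk q.toFun y t
      = (∑ m, (∑ k, Dk.β y t k m * q.form y (Pi.single k 1)) ^ 2) / q.den y := by
  have hr : ∀ m, (∑ k, Dk.β y t k m * q.form y (Pi.single k 1)) ^ 2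
      = ∑ k, ∑ l, Dk.β y t k m * q.form y (Pi.single k 1)
        * (Dk.β y t l m * q.form y (Pi.single l 1)) := fun m => by
    rw [pow_two, Finset.sum_mul_sum]
  simp only [Aop, q.dmix_toFun hy, hr, Matrix.mul_apply, Matrix.transpose_apply, Finset.sum_div,
    Finset.sum_mul]
  conv_rhs => rw [Finset.sum_comm]
  refine Finset.sum_congr rfl fun k _ => ?_
  conv_rhs => rw [Finset.sum_comm]
  refine Finset.sum_congr rfl fun l _ => Finset.sum_congr rfl fun m _ => ?_
  have := (q.den_pos hy).ne'
  field_simp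

theorem lcp_diffusion {T : ℝ} {Dk : DiffKernel n T} {t : ℝ} (ht : t ∈ Icc (0:ℝ) T)
    (hx : q.x ∈ posOrth n) (hA : IsLCPAt (Aop Dk) q.x t) {v : Fin n → ℝ} (hv : v ≠ 0)
    (hpv : q.p v = 0) :
    0 ≤ deriv^[2] (fun s : ℝ => (∑ m, (∑ k, Dk.β (q.x + s • v) t k m
      * q.p (Pi.single k 1)) ^ 2) / (q.e (q.x + s • v) + q.c)) 0 := by
  have hline : ∀ s : ℝ, q.p (q.x + s • v - q.x) = 0 := fun s => by simp [hpv]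
  have hpos := hA v hv q.toFun q.memTestClass q.convexOn (by
    rw [dir2, q.dmix_toFun hx, q.form_of_num_eq_zero (by simp), hpv, mul_zero])
  set G : (Fin n → ℝ) → ℝ := fun y =>
    (∑ m, (∑ k, Dk.β y t k m * q.form y (Pi.single k 1)) ^ 2) / q.den y
  have hev : (fun y => Aop Dk q.toFun y t) =ᶠ[nhds q.x] G := by
    filter_upwards [posOrth_mem_nhds hx] with y hy using q.Aop_toFun Dk hy t
  have hG : ContDiffOn ℝ 2 G (posOrth n) := by
    refine ContDiffOn.div ?_ (q.e.contDiff.add contDiff_const).contDiffOn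
      fun _ hy => (q.den_pos hy).ne'
    refine ContDiffOn.sum fun m _ => ContDiffOn.pow (ContDiffOn.sum fun k _ => ?_) 2
    refine (Dk.smooth t ht k m).mul ?_
    have : ∀ y, q.form y (Pi.single k 1)
        = q.p (Pi.single k 1) - q.ratio y * q.e (Pi.single k 1) := fun y => rfl
    simp only [this]
    exact contDiffOn_const.sub ((q.contDiffOn_ratio.of_le (by norm_num)).mul contDiffOn_const)
  have hGx := hG.contDiffAt (posOrth_mem_nhds hx)
  rw [dir2_eq_deriv2_zero (hGx.congr_of_eventuallyEq hev)] at hpos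
  have hev2 : (fun s : ℝ => Aop Dk q.toFun (q.x + s • v) t) =ᶠ[nhds 0] fun s : ℝ =>
      (∑ m, (∑ k, Dk.β (q.x + s • v) t k m * q.p (Pi.single k 1)) ^ 2)
        / (q.e (q.x + s • v) + q.c) := by
    have : ∀ᶠ s in nhds (0:ℝ), q.x + s • v ∈ posOrth n :=
      eventually_line_mem (by simpa using posOrth_mem_nhds hx)
    filter_upwards [this] with s hs
    rw [q.Aop_toFun Dk hs t, q.form_of_num_eq_zero (hline s), den]
  simp only [Function.iterate_succ, Function.iterate_zero, Function.comp_apply, id] at hpos ⊢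
  rwa [hev2.deriv.deriv_eq] at hpos

end QuadOverLin

/-! ### Diffusion coefficients whose rows depend on one variable -/

theorem sum_mul_proj_sub_proj {n : ℕ} (f : Fin n → ℝ) (c d : ℝ) (i j : Fin n) :
    ∑ k, f k * (c • (ContinuousLinearMap.proj i : (Fin n → ℝ) →L[ℝ] ℝ)
      - d • (ContinuousLinearMap.proj j : (Fin n → ℝ) →L[ℝ] ℝ)) (Pi.single k 1)
      = c * f i - d * f j := by
  simp [mul_sub, Pi.single_apply, Finset.sum_sub_distrib, mul_comm]

theorem ContDiffAt.eventually_hasDerivAt_deriv {f : ℝ → ℝ} {c : ℝ} (hf : ContDiffAt ℝ 2 f c) :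
    ∀ᶠ r in nhds c, HasDerivAt f (deriv f r) r := by
  filter_upwards [hf.eventually (by simp)] with r hr
  exact (hr.differentiableAt two_ne_zero).hasDerivAt

theorem ContDiffAt.hasDerivAt_deriv2 {f : ℝ → ℝ} {c : ℝ} (hf : ContDiffAt ℝ 2 f c) :
    HasDerivAt (deriv f) (deriv^[2] f c) c := by
  have h : ContDiffAt ℝ 1 (fun y => fderiv ℝ f y 1) c :=
    (hf.fderiv_right (m := 1) (by norm_num)).clm_apply contDiffAt_const
  exact (h.differentiableAt one_ne_zero).hasDerivAt

theorem monotoneOn_div_of_convexOn {f : ℝ → ℝ} {C : ℝ} (hf : ConvexOn ℝ (Ioi 0) f)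
    (hbd : ∀ s ∈ Ioi (0:ℝ), |f s| ≤ C * s) : MonotoneOn (fun s => f s / s) (Ioi 0) := by
  refine monotoneOn_of_convexOn_id_mul (C := C)
    (hf.congr fun s hs => (mul_div_cancel₀ _ (ne_of_gt hs)).symm) (fun _ h => h)
    (fun _ _ r hr _ => hr) fun s hs => ?_
  rw [abs_div, abs_of_pos (mem_Ioi.1 hs)]
  exact (div_le_iff₀ hs).2 (hbd s hs)

theorem convexOn_Ioi_of_deriv2_nonneg {f : ℝ → ℝ} (hf : ContDiffOn ℝ 2 f (Ioi 0))
    (h2 : ∀ s ∈ Ioi (0:ℝ), 0 ≤ deriv^[2] f s) : ConvexOn ℝ (Ioi 0) f :=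
  convexOn_of_deriv2_nonneg' (convex_Ioi 0) (hf.differentiableOn two_ne_zero)
    (fun _ hs => (hf.contDiffAt
      (Ioi_mem_nhds hs)).hasDerivAt_deriv2.differentiableAt.differentiableWithinAt) h2

/-- A function on the half-line with vanishing second derivative and at most linear growth is
linear. -/
theorem div_eq_div_of_deriv2_eq_zero {f : ℝ → ℝ} {C : ℝ} (hf : ContDiffOn ℝ 2 f (Ioi 0))
    (h2 : ∀ s ∈ Ioi (0:ℝ), deriv^[2] f s = 0) (hbd : ∀ s ∈ Ioi (0:ℝ), |f s| ≤ C * s)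
    {s s' : ℝ} (hs : 0 < s) (hs' : 0 < s') : f s / s = f s' / s' := by
  have hm := monotoneOn_div_of_convexOn
    (convexOn_Ioi_of_deriv2_nonneg hf fun s hs => (h2 s hs).ge) hbd
  have hconc : ConvexOn ℝ (Ioi 0) fun s => -f s := by
    refine convexOn_Ioi_of_deriv2_nonneg hf.neg fun s hs => ?_
    simpa using! (h2 s hs).le
  have hm' := monotoneOn_div_of_convexOn hconc (C := C) (by simpa using hbd)
  simp only [neg_div] at hm'
  rcases le_total s s' with h | h
  · exact le_antisymm (hm hs hs' h) (neg_le_neg_iff.1 (hm' hs hs' h))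
  · exact le_antisymm (neg_le_neg_iff.1 (hm' hs' hs h)) (hm hs' hs h)

/-- Leading term, for `u → 0`, of the second derivative of a sum of squares. -/
theorem sum_mul_deriv2_eq_zero {ι : Type*} [Fintype ι] {B C : ι → ℝ → ℝ} {a b : ℝ}
    (hB : ∀ m, ContDiffAt ℝ 2 (B m) a) (hC : ∀ m, ContDiffAt ℝ 2 (C m) b)
    (h : ∀ u : ℝ, 0 ≤ deriv^[2]
      (fun s : ℝ => ∑ m, (u * B m (a + s * 1) - 1 * C m (b + s * u)) ^ 2) 0) :
    ∑ m, C m b * deriv^[2] (B m) a = 0 := by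
  have line : ∀ c u s : ℝ, HasDerivAt (fun s : ℝ => c + s * u) u s := fun c u s => by
    simpa using ((hasDerivAt_id s).mul_const u).const_add c
  have hev : ∀ {f : ℝ → ℝ} {c : ℝ} (u : ℝ), ContDiffAt ℝ 2 f c →
      ∀ᶠ s in nhds (0:ℝ), HasDerivAt (fun s => f (c + s * u)) (deriv f (c + s * u) * u) s :=
    fun {f c} u hf => by
      have hc : Filter.Tendsto (fun s : ℝ => c + s * u) (nhds 0) (nhds c) := by
        have : Continuous fun s : ℝ => c + s * u := by fun_prop
        simpa using this.tendsto 0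
      filter_upwards [hc.eventually hf.eventually_hasDerivAt_deriv] with s hs
      exact hs.comp s (line c u s)
  have hev' : ∀ {f : ℝ → ℝ} {c : ℝ} (u : ℝ), ContDiffAt ℝ 2 f c →
      HasDerivAt (fun s => deriv f (c + s * u)) (deriv^[2] f c * u) 0 :=
    fun {f c} u hf => by
      have h1 : HasDerivAt (deriv f) (deriv^[2] f c) (c + 0 * u) := by simpa using hf.hasDerivAt_deriv2
      exact h1.comp 0 (line c u 0)
  set k : ℝ → ℝ := fun u => ∑ m, (2 * u * (deriv (B m) a - deriv (C m) b) ^ 2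
    + 2 * (u * B m a - C m b) * (deriv^[2] (B m) a - u * deriv^[2] (C m) b))
  have hk : ∀ u, deriv^[2]
      (fun s : ℝ => ∑ m, (u * B m (a + s * 1) - 1 * C m (b + s * u)) ^ 2) 0 = u * k u := by
    intro u
    refine deriv2_eq_of_hasDerivAt (g' := fun s => ∑ m, 2 * (u * B m (a + s * 1)
      - 1 * C m (b + s * u)) * (u * (deriv (B m) (a + s * 1) * 1)
        - 1 * (deriv (C m) (b + s * u) * u))) ?_ ?_
    · have : ∀ᶠ s in nhds (0:ℝ), ∀ m,
          HasDerivAt (fun s => B m (a + s * 1)) (deriv (B m) (a + s * 1) * 1) s ∧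
          HasDerivAt (fun s => C m (b + s * u)) (deriv (C m) (b + s * u) * u) s :=
        Filter.eventually_all.2 fun m => (hev 1 (hB m)).and (hev u (hC m))
      filter_upwards [this] with s hs
      refine HasDerivAt.fun_sum fun m _ => ?_
      have := (((hs m).1.const_mul u).sub ((hs m).2.const_mul 1)).fun_pow 2
      simpa using this
    · have hm : ∀ m, HasDerivAt (fun s => 2 * (u * B m (a + s * 1)
          - 1 * C m (b + s * u)) * (u * (deriv (B m) (a + s * 1) * 1)
            - 1 * (deriv (C m) (b + s * u) * u)))
          (u * (2 * u * (deriv (B m) a - deriv (C m) b) ^ 2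
            + 2 * (u * B m a - C m b) * (deriv^[2] (B m) a - u * deriv^[2] (C m) b))) 0 := by
        intro m
        have h1 := (hev 1 (hB m)).self_of_nhds
        have h2 := (hev u (hC m)).self_of_nhds
        have h3 := hev' 1 (hB m)
        have h4 := hev' u (hC m)
        have h5 := (((h1.const_mul u).sub (h2.const_mul 1)).const_mul 2).mul
          (((h3.mul_const 1).const_mul u).sub ((h4.mul_const u).const_mul 1))
        refine h5.congr_deriv ?_
        simp
        ring
      refine (HasDerivAt.fun_sum fun m _ => hm m).congr_deriv ?_
      rw [Finset.mul_sum]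
  have hk0 : k 0 = 0 := by
    refine eq_zero_of_forall_mul_nonneg (by fun_prop) fun u => ?_
    rw [← hk u]
    exact h u
  have : k 0 = -2 * ∑ m, C m b * deriv^[2] (B m) a := by
    simp only [k, Finset.mul_sum]
    refine Finset.sum_congr rfl fun m _ => ?_
    ring
  linarith

namespace DiffKernel

variable {n : ℕ} {T : ℝ} (Dk : DiffKernel n T) {t : ℝ}

/-- The coefficients along the diagonal, as functions of one variable. -/
def coef (t : ℝ) (i m : Fin n) (s : ℝ) : ℝ := Dk.β (fun _ => s) t i m

theorem contDiffOn_coef (ht : t ∈ Icc (0:ℝ) T) (i m : Fin n) :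
    ContDiffOn ℝ 2 (Dk.coef t i m) (Ioi 0) :=
  (Dk.smooth t ht i m).comp (g := fun x => Dk.β x t i m) (f := fun (s : ℝ) (_ : Fin n) => s)
    (contDiff_pi.2 fun _ => contDiff_id).contDiffOn fun _ hs _ => hs

/-- The rows of the diffusion matrix depend on the corresponding coordinate only. -/
def RowDep (t : ℝ) : Prop :=
  ∀ i j : Fin n, ∀ x ∈ posOrth n, ∀ y ∈ posOrth n, x i = y i → Dk.β x t i j = Dk.β y t i j

variable {Dk}

theorem RowDep.eq_coef (hdep : Dk.RowDep t) {x : Fin n → ℝ} (hx : x ∈ posOrth n)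
    (i m : Fin n) : Dk.β x t i m = Dk.coef t i m (x i) :=
  hdep i m x hx _ (fun _ => hx i) rfl

theorem RowDep.nonneg_of_lcp (hdep : Dk.RowDep t) (ht : t ∈ Icc (0:ℝ) T)
    (hA : ∀ x ∈ posOrth n, IsLCPAt (Aop Dk) x t) {i j : Fin n} (hij : i ≠ j)
    {a b p q c d κ ε : ℝ} (ha : 0 < a) (hb : 0 < b) (hp : p ≠ 0) (hpq : c * p = d * q)
    (hκ : 0 ≤ κ) (hε : 0 < ε) :
    0 ≤ deriv^[2] (fun s : ℝ => (∑ m, (c * Dk.coef t i m (a + s * p)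
      - d * Dk.coef t j m (b + s * q)) ^ 2) / (κ * (a + s * p) + ε)) 0 := by
  set x : Fin n → ℝ := Function.update (Function.update (fun _ => 1) i a) j b
  set v : Fin n → ℝ := Function.update (Function.update (fun _ => 0) i p) j q
  have hxi : x i = a := by simp [x, hij]
  have hxj : x j = b := by simp [x]
  have hvi : v i = p := by simp [v, hij]
  have hvj : v j = q := by simp [v]
  have hx : x ∈ posOrth n := fun k => by
    by_cases hkj : k = j
    · rw [hkj, hxj]; exact hb
    by_cases hki : k = i
    · rw [hki, hxi]; exact ha
    simp [x, hkj, hki]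
  let Q : QuadOverLin n :=
    { p := c • (ContinuousLinearMap.proj i : (Fin n → ℝ) →L[ℝ] ℝ)
        - d • (ContinuousLinearMap.proj j : (Fin n → ℝ) →L[ℝ] ℝ)
      e := κ • (ContinuousLinearMap.proj i : (Fin n → ℝ) →L[ℝ] ℝ)
      x := x
      c := ε
      c_pos := hε
      e_nonneg := fun y hy => mul_nonneg hκ (hy i).le }
  have h := Q.lcp_diffusion ht hx (hA x hx) (v := v) (fun h0 => hp (by rw [← hvi, h0]; rfl))
    (by simp [Q, hvi, hvj, hpq])
  have hev : (fun s : ℝ => (∑ m, (∑ k, Dk.β (Q.x + s • v) t k m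
      * Q.p (Pi.single k 1)) ^ 2) / (Q.e (Q.x + s • v) + Q.c)) =ᶠ[nhds 0]
      fun s : ℝ => (∑ m, (c * Dk.coef t i m (a + s * p)
        - d * Dk.coef t j m (b + s * q)) ^ 2) / (κ * (a + s * p) + ε) := by
    have : ∀ᶠ s in nhds (0:ℝ), x + s • v ∈ posOrth n :=
      eventually_line_mem (by simpa using posOrth_mem_nhds hx)
    filter_upwards [this] with s hs
    have hsum : ∀ m, ∑ k, Dk.β (Q.x + s • v) t k m * Q.p (Pi.single k 1)
        = c * Dk.coef t i m (a + s * p) - d * Dk.coef t j m (b + s * q) := fun m => by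
      rw [sum_mul_proj_sub_proj (fun k => Dk.β (Q.x + s • v) t k m), hdep.eq_coef hs,
        hdep.eq_coef hs]
      simp [hxi, hxj, hvi, hvj]
    simp only [hsum]
    simp [Q, hxi, hvi]
  simp only [Function.iterate_succ, Function.iterate_zero, Function.comp_apply, id] at h ⊢
  rwa [hev.deriv.deriv_eq] at h

theorem sum_sq_coef_le {D : ℝ}
    (hD : ∀ x ∈ posOrth n, ∀ i, ∑ m, Dk.β x t i m ^ 2 ≤ D * x i ^ 2) (i : Fin n) {s : ℝ}
    (hs : 0 < s) : ∑ m, Dk.coef t i m s ^ 2 ≤ D * s ^ 2 :=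
  hD (fun _ => s) (fun _ => hs) i

/-- The normalised covariance of two different rows does not depend on the first variable. -/
theorem RowDep.sum_coef_mul_coef_div (hdep : Dk.RowDep t) (ht : t ∈ Icc (0:ℝ) T)
    (hA : ∀ x ∈ posOrth n, IsLCPAt (Aop Dk) x t) {i j : Fin n} (hij : i ≠ j)
    {r s s' : ℝ} (hr : 0 < r) (hs : 0 < s) (hs' : 0 < s') :
    (∑ m, Dk.coef t i m s * Dk.coef t j m r) / s
      = (∑ m, Dk.coef t i m s' * Dk.coef t j m r) / s' := by
  obtain ⟨D, hD0, hD⟩ := Dk.bound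
  set G : ℝ → ℝ := fun s => ∑ m, Dk.coef t i m s * Dk.coef t j m r
  have hG : ContDiffOn ℝ 2 G (Ioi 0) :=
    ContDiffOn.sum fun m _ => (Dk.contDiffOn_coef ht i m).mul contDiffOn_const
  have hat : ∀ {f : ℝ → ℝ} {c : ℝ}, ContDiffOn ℝ 2 f (Ioi 0) → 0 < c → ContDiffAt ℝ 2 f c :=
    fun hf hc => hf.contDiffAt (Ioi_mem_nhds hc)
  have hG2 : ∀ a, 0 < a → deriv^[2] G a = 0 := fun a ha => by
    have h := sum_mul_deriv2_eq_zero (B := Dk.coef t i) (C := Dk.coef t j) (a := a) (b := r)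
      (fun m => hat (Dk.contDiffOn_coef ht i m) ha) (fun m => hat (Dk.contDiffOn_coef ht j m) hr)
      fun u => by
        simpa using hdep.nonneg_of_lcp ht hA hij (c := u) (d := 1) (p := 1) (q := u) (κ := 0)
          (ε := 1) ha hr one_ne_zero (by ring) le_rfl one_pos
    rw [← h]
    refine deriv2_eq_of_hasDerivAt
      (g' := fun s => ∑ m, deriv (Dk.coef t i m) s * Dk.coef t j m r) ?_ ?_
    · filter_upwards [Ioi_mem_nhds ha] with s hs
      exact HasDerivAt.fun_sum fun m _ => ((hat (Dk.contDiffOn_coef ht i m) hs).differentiableAt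
        two_ne_zero).hasDerivAt.mul_const _
    · simp only [mul_comm (Dk.coef t j _ r)]
      exact HasDerivAt.fun_sum fun m _ =>
        (hat (Dk.contDiffOn_coef ht i m) ha).hasDerivAt_deriv2.mul_const _
  refine div_eq_div_of_deriv2_eq_zero (C := D * r) hG hG2 (fun s hs => ?_) hs hs'
  have hs0 : 0 < s := hs
  refine abs_le_of_sq_le_sq ?_ (by positivity)
  calc G s ^ 2 ≤ (∑ m, Dk.coef t i m s ^ 2) * ∑ m, Dk.coef t j m r ^ 2 :=
        Finset.sum_mul_sq_le_sq_mul_sq _ _ _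
    _ ≤ (D * s ^ 2) * (D * r ^ 2) := by
        have h1 := Dk.sum_sq_coef_le (fun x hx => hD x hx t ht) i hs0
        have h2 := Dk.sum_sq_coef_le (fun x hx => hD x hx t ht) j hr
        gcongr
    _ = _ := by ring

theorem RowDep.convexOn_div (hdep : Dk.RowDep t) (ht : t ∈ Icc (0:ℝ) T)
    (hA : ∀ x ∈ posOrth n, IsLCPAt (Aop Dk) x t) {i j : Fin n} (hij : i ≠ j)
    {a b : ℝ} (ha : 0 < a) (hb : 0 < b) :
    ConvexOn ℝ (Ioi 0) fun s =>
      (∑ m, (b * Dk.coef t i m (s * a) - a * Dk.coef t j m (s * b)) ^ 2) / s := by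
  set Q : ℝ → ℝ := fun s => ∑ m, (b * Dk.coef t i m (s * a) - a * Dk.coef t j m (s * b)) ^ 2
  have hmaps : ∀ {a : ℝ}, 0 < a → MapsTo (fun s : ℝ => s * a) (Ioi 0) (Ioi 0) :=
    fun ha s hs => mul_pos hs ha
  have hQ : ContDiffOn ℝ 2 Q (Ioi 0) := by
    refine ContDiffOn.sum fun m _ => ContDiffOn.pow (ContDiffOn.sub
      (contDiffOn_const.mul ?_) (contDiffOn_const.mul ?_)) 2
    · exact (Dk.contDiffOn_coef ht i m).comp (contDiff_id.mul contDiff_const).contDiffOn (hmaps ha)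
    · exact (Dk.contDiffOn_coef ht j m).comp (contDiff_id.mul contDiff_const).contDiffOn (hmaps hb)
  have hconv : ∀ ε : ℝ, 0 < ε → ConvexOn ℝ (Ioi 0) fun s => Q s / (s + ε) := fun ε hε => by
    refine convexOn_Ioi_of_deriv2_nonneg (hQ.div (contDiff_id.add contDiff_const).contDiffOn
      fun s hs => (add_pos hs hε).ne') fun s hs => ?_
    have hs0 : 0 < s := hs
    have h := hdep.nonneg_of_lcp ht hA hij (c := b) (d := a) (p := a) (q := b) (κ := a⁻¹)
      (ε := ε) (mul_pos hs0 ha) (mul_pos hs0 hb) ha.ne' (mul_comm _ _) (by positivity) hε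
    have he : (fun r : ℝ => (∑ m, (b * Dk.coef t i m (s * a + r * a)
        - a * Dk.coef t j m (s * b + r * b)) ^ 2) / (a⁻¹ * (s * a + r * a) + ε))
        = fun r => (fun s => Q s / (s + ε)) (s + r) := by
      ext r
      have : a⁻¹ * (s * a + r * a) = s + r := by field_simp
      simp only [this, Q, add_mul]
    rw [he] at h
    simp only [Function.iterate_succ, Function.iterate_zero, Function.comp_apply, id] at h ⊢
    have hd : (deriv fun r => (fun s => Q s / (s + ε)) (s + r))
        = fun r => deriv (fun s => Q s / (s + ε)) (s + r) :=
      funext fun r => deriv_comp_const_add (fun s => Q s / (s + ε)) s r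
    rwa [hd, deriv_comp_const_add (deriv fun s => Q s / (s + ε)) s 0, add_zero] at h
  refine ⟨convex_Ioi 0, fun x hx y hy p q hp hq hpq => ?_⟩
  have hlim : ∀ z ∈ Ioi (0:ℝ), Filter.Tendsto (fun ε => Q z / (z + ε)) (nhdsWithin 0 (Ioi 0))
      (nhds (Q z / z)) := fun z hz => by
    have : ContinuousAt (fun ε => Q z / (z + ε)) 0 :=
      continuousAt_const.div (by fun_prop) (by simpa using ne_of_gt hz)
    have h := this.tendsto
    rw [add_zero] at h
    exact h.mono_left nhdsWithin_le_nhds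
  refine le_of_tendsto_of_tendsto (hlim _ (convex_Ioi (0:ℝ) hx hy hp hq hpq))
    (((hlim x hx).const_smul p).add ((hlim y hy).const_smul q)) ?_
  filter_upwards [self_mem_nhdsWithin] with ε hε
  exact (hconv ε hε).2 hx hy hp hq hpq

/-- The relative squared volatility of every row is nondecreasing. -/
theorem RowDep.monotoneOn_sum_sq_coef (hdep : Dk.RowDep t) (ht : t ∈ Icc (0:ℝ) T)
    (hA : ∀ x ∈ posOrth n, IsLCPAt (Aop Dk) x t) {i j : Fin n} (hij : i ≠ j) :
    MonotoneOn (fun s => (∑ m, Dk.coef t i m s ^ 2) / s ^ 2) (Ioi 0) := by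
  obtain ⟨D, hD0, hD⟩ := Dk.bound
  have hle : ∀ k, ∀ s : ℝ, 0 < s → ∑ m, Dk.coef t k m s ^ 2 ≤ D * s ^ 2 := fun k s hs =>
    Dk.sum_sq_coef_le (fun x hx => hD x hx t ht) k hs
  refine monotoneOn_of_add_dilate (g := fun s => (∑ m, Dk.coef t j m s ^ 2) / s ^ 2) (M := D)
    (fun s hs => ?_) fun a b ha hb => ?_
  · have hs0 : 0 < s := hs
    rw [abs_of_nonneg (by positivity), div_le_iff₀ (by positivity)]
    exact hle j s hs0
  · set N : ℝ := ∑ m, Dk.coef t i m 1 * Dk.coef t j m 1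
    have hN : ∀ s, 0 < s → ∑ m, Dk.coef t i m (s * a) * Dk.coef t j m (s * b)
        = (s * a) * (s * b) * N := fun s hs => by
      have h1 := hdep.sum_coef_mul_coef_div ht hA hij (mul_pos hs hb) (mul_pos hs ha) one_pos
      have h2 := hdep.sum_coef_mul_coef_div ht hA hij.symm one_pos (mul_pos hs hb) one_pos
      simp only [mul_comm (Dk.coef t j _ _)] at h2
      rw [div_one, div_eq_iff (mul_pos hs ha).ne'] at h1
      rw [div_one, div_eq_iff (mul_pos hs hb).ne'] at h2
      rw [h1, h2]
      ring
    have hexp : ∀ s, 0 < s →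
        ∑ m, (b * Dk.coef t i m (s * a) - a * Dk.coef t j m (s * b)) ^ 2
        = b ^ 2 * ∑ m, Dk.coef t i m (s * a) ^ 2 + a ^ 2 * ∑ m, Dk.coef t j m (s * b) ^ 2
          - 2 * a * b * ((s * a) * (s * b) * N) := fun s hs => by
      rw [← hN s hs]
      simp only [Finset.mul_sum, ← Finset.sum_add_distrib, ← Finset.sum_sub_distrib]
      refine Finset.sum_congr rfl fun m _ => ?_
      ring
    have hm := monotoneOn_div_of_convexOn (hdep.convexOn_div ht hA hij ha hb)
      (C := 2 * D * a ^ 2 * b ^ 2 + 2 * a ^ 2 * b ^ 2 * |N|) fun s hs => by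
        have hs0 : 0 < s := hs
        rw [abs_of_nonneg (by positivity), div_le_iff₀ hs0, hexp s hs0]
        have h1 := mul_le_mul_of_nonneg_left (hle i (s * a) (by positivity)) (sq_nonneg b)
        have h2 := mul_le_mul_of_nonneg_left (hle j (s * b) (by positivity)) (sq_nonneg a)
        have h3 : 0 ≤ (2 * a ^ 2 * b ^ 2 * s ^ 2) * (|N| + N) :=
          mul_nonneg (by positivity) (by linarith [neg_abs_le N])
        nlinarith
    have he : ∀ s ∈ Ioi (0:ℝ), (∑ m, Dk.coef t i m (s * a) ^ 2) / (s * a) ^ 2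
        + (∑ m, Dk.coef t j m (s * b) ^ 2) / (s * b) ^ 2
        = (a ^ 2 * b ^ 2)⁻¹ * ((∑ m, (b * Dk.coef t i m (s * a)
          - a * Dk.coef t j m (s * b)) ^ 2) / s / s) + 2 * N := fun s hs => by
      have hs0 : s ≠ 0 := ne_of_gt hs
      rw [hexp s hs]
      field_simp
      ring
    intro s hs s' hs' hss'
    change (∑ m, Dk.coef t i m (s * a) ^ 2) / (s * a) ^ 2
        + (∑ m, Dk.coef t j m (s * b) ^ 2) / (s * b) ^ 2
      ≤ (∑ m, Dk.coef t i m (s' * a) ^ 2) / (s' * a) ^ 2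
        + (∑ m, Dk.coef t j m (s' * b) ^ 2) / (s' * b) ^ 2
    rw [he s hs, he s' hs']
    have := hm hs hs' hss'
    gcongr

end DiffKernel

/-- If the normalised rows have constant length, the coefficients are linear. -/
theorem DiffKernel.RowDep.coef_div_eq {n : ℕ} {T : ℝ} {Dk : DiffKernel n T} {t : ℝ}
    (hdep : Dk.RowDep t) (ht : t ∈ Icc (0:ℝ) T)
    (hA : ∀ x ∈ posOrth n, IsLCPAt (Aop Dk) x t) {i : Fin n} {s s' : ℝ} (hs : 0 < s)
    (hs' : 0 < s')
    (hc : (∑ m, Dk.coef t i m s ^ 2) / s ^ 2 = (∑ m, Dk.coef t i m s' ^ 2) / s' ^ 2)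
    (m : Fin n) : Dk.coef t i m s / s = Dk.coef t i m s' / s' := by
  set d : Fin n → ℝ := fun m => Dk.coef t i m s / s - Dk.coef t i m s' / s'
  suffices hd : d = 0 from sub_eq_zero.1 (congrFun hd m)
  have hother : ∀ j, i ≠ j → ∑ m, Dk.coef t j m 1 * d m = 0 := fun j hij => by
    have := sub_eq_zero.2 (hdep.sum_coef_mul_coef_div ht hA hij one_pos hs hs')
    simp only [Finset.sum_div, ← Finset.sum_sub_distrib] at this
    rw [← this]
    refine Finset.sum_congr rfl fun m _ => ?_
    simp only [d]
    ring
  set h : ℝ → ℝ := fun r => ∑ m, Dk.coef t i m r / r * d m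
  have hsum : h s' = -h s := by
    rw [eq_neg_iff_add_eq_zero, add_comm, ← sub_eq_zero.2 hc]
    simp only [h, Finset.sum_div, ← Finset.sum_add_distrib, ← Finset.sum_sub_distrib]
    refine Finset.sum_congr rfl fun m _ => ?_
    simp only [d]
    ring
  have hcont : ContinuousOn h (Ioi 0) := continuousOn_finsetSum _ fun m _ =>
    ((Dk.contDiffOn_coef ht i m).continuousOn.div continuousOn_id
      fun r hr => ne_of_gt hr).mul continuousOn_const
  have hsub : uIcc s s' ⊆ Ioi 0 := fun r hr => (lt_min hs hs').trans_le hr.1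
  obtain ⟨ξ, hξ, hξ0⟩ : (0:ℝ) ∈ h '' uIcc s s' := by
    refine intermediate_value_uIcc (hcont.mono hsub) ?_
    rw [hsum, mem_uIcc]
    rcases le_total 0 (h s) with h0 | h0
    · exact Or.inr ⟨by linarith, h0⟩
    · exact Or.inl ⟨h0, by linarith⟩
  have hξpos : 0 < ξ := hsub hξ
  have hx : Function.update (fun _ => (1:ℝ)) i ξ ∈ posOrth n := fun k => by
    by_cases hk : k = i
    · subst hk; simpa using hξpos
    · simp [hk]
  refine Matrix.eq_zero_of_mulVec_eq_zero (Dk.nonsing _ hx t ht) (funext fun k => ?_)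
  simp only [Matrix.mulVec, dotProduct, hdep.eq_coef hx, Pi.zero_apply]
  by_cases hk : k = i
  · subst hk
    simp only [h, div_mul_eq_mul_div, ← Finset.sum_div] at hξ0
    simpa [hξpos.ne'] using hξ0
  · simpa [hk] using hother k (Ne.symm hk)

/-- Two nondecreasing functions whose weighted sum is constant are constant. -/
theorem MonotoneOn.eq_of_add_mul_eq {P R : ℝ → ℝ} {S : Set ℝ} (hP : MonotoneOn P S)
    (hR : MonotoneOn R S) {c : ℝ} (hc : 0 < c)
    (h : ∀ s ∈ S, ∀ s' ∈ S, P s + c * R s = P s' + c * R s') {s s' : ℝ} (hs : s ∈ S)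
    (hs' : s' ∈ S) : P s = P s' ∧ R s = R s' := by
  wlog hle : s ≤ s' generalizing s s'
  · exact (this hs' hs (le_of_not_ge hle)).imp Eq.symm Eq.symm
  have h1 := hP hs hs' hle
  have h2 := hR hs hs' hle
  have h3 := h s hs s' hs'
  constructor <;> nlinarith

theorem update_mem_posOrth {n : ℕ} {x : Fin n → ℝ} (hx : x ∈ posOrth n) (i : Fin n) {s : ℝ}
    (hs : 0 < s) : Function.update x i s ∈ posOrth n := fun k => by
  by_cases hk : k = i
  · subst hk; simpa using hs
  · simpa [hk] using hx k

theorem monotoneOn_relMoment_update {n : ℕ} {F : (Fin n → ℝ) → ℝ → ℝ} (h : LocUnifC2 F)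
    (hJ : ∀ x ∈ posOrth n, ∀ v : Fin n → ℝ, v ≠ 0 →
      0 ≤ ∫ z in Icc (0:ℝ) 1, F x z * dir2 (fun y => F y z) x v) {i : Fin n} {D : ℝ}
    (hD : ∀ x ∈ posOrth n, ∀ z ∈ Icc (0:ℝ) 1, F x z ^ 2 ≤ D * x i ^ 2)
    {x : Fin n → ℝ} (hx : x ∈ posOrth n) :
    MonotoneOn (fun s => (∫ z in Icc (0:ℝ) 1, F (Function.update x i s) z ^ 2) / s ^ 2)
      (Ioi 0) := by
  have he : ∀ s : ℝ, Function.update x i 0 + s • Pi.single i 1 = Function.update x i s := by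
    intro s
    ext k
    by_cases hk : k = i
    · subst hk; simp
    · simp [hk]
  intro s hs s' hs' hss'
  have hm := update_mem_posOrth hx i hs
  have hm' := update_mem_posOrth hx i hs'
  have := h.monotone_ray hJ hD (b := Function.update x i 0) (v := Pi.single i 1)
    (fun k => by
      by_cases hk : k = i
      · subst hk; simp
      · simpa [hk] using (hx k).le)
    (by simp) (by simp) hs hss' (by rwa [he]) (by rwa [he])
  simpa only [he] using this

/-- Theorem 6.3: let `n ≥ 2`, suppose that for each fixed `(x,t)` the map `z ↦ φ(x,t,z)`
takes at most finitely many values, that each `β_ij` depends only on `x_i` and `t`, and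
that for every `i` and every fixed `t` the total volatility
`x_i ↦ √(( Σ_j β_ij(x_i,t)² + λ(t)² ∫₀¹ φ_i(x,t,z)² dz ) / x_i²)` is not a nondecreasing
function of `x_i` unless it is constant. If both `A` and `B` are LCP at all points of
`(0,∞)ⁿ × [0,T]`, then the coefficients are linear: `β_ij(x_i,t) = x_i γ_ij(t)` and
`φ_i(x,t,z) = x_i γ_i(t,z)` for almost all `z`; in particular `φ_i` does not depend on
`x_j` for `j ≠ i`. -/
theorem linear_coefficients_of_lcp {n : ℕ} (hn : 2 ≤ n) {T : ℝ} (hT : 0 < T)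
    (K : JumpKernel n T) (hK : K.AENonzero)
    (Dk : DiffKernel n T)
    (lam : ℝ → ℝ) (hlam : LamOK T lam)
    (hlampos : ∀ s ∈ Set.Icc (0:ℝ) T, 0 < lam s)
    (hfin : ∀ x ∈ posOrth n, ∀ t ∈ Set.Icc (0:ℝ) T,
      ((fun z => K.φ x t z) '' Set.Icc (0:ℝ) 1).Finite)
    (hβdep : ∀ t ∈ Set.Icc (0:ℝ) T, ∀ i j : Fin n, ∀ x ∈ posOrth n, ∀ y ∈ posOrth n,
      x i = y i → Dk.β x t i j = Dk.β y t i j)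
    (hvol : ∀ i : Fin n, ∀ t ∈ Set.Icc (0:ℝ) T, ∀ x ∈ posOrth n, ∀ g : ℝ → ℝ,
      (g = fun s : ℝ => Real.sqrt
        ((∑ j, (Dk.β (Function.update x i s) t i j) ^ 2
          + (lam t) ^ 2 * ∫ z in Icc (0:ℝ) 1, (K.φ (Function.update x i s) t z i) ^ 2)
          / s ^ 2)) →
      MonotoneOn g (Ioi (0:ℝ)) → ∀ s ∈ Ioi (0:ℝ), ∀ s' ∈ Ioi (0:ℝ), g s = g s')
    (hA : ∀ x ∈ posOrth n, ∀ t ∈ Set.Icc (0:ℝ) T, IsLCPAt (Aop Dk) x t)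
    (hB : ∀ x ∈ posOrth n, ∀ t ∈ Set.Icc (0:ℝ) T, IsLCPAt (Bop lam K) x t) :
    ∃ γmat : Fin n → Fin n → ℝ → ℝ, ∃ γjump : Fin n → ℝ → ℝ → ℝ,
      (∀ t ∈ Set.Icc (0:ℝ) T, ∀ x ∈ posOrth n, ∀ i j : Fin n,
        Dk.β x t i j = x i * γmat i j t) ∧
      (∀ i : Fin n, ∀ t ∈ Set.Icc (0:ℝ) T, ∀ x ∈ posOrth n,
        ∀ᵐ z ∂(volume.restrict (Icc (0:ℝ) 1)), K.φ x t z i = x i * γjump i t z) := by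
  have hone : (fun _ => 1) ∈ posOrth n := fun _ => one_pos
  obtain ⟨D, -, hD⟩ := K.bound
  have hloc := fun (i : Fin n) (t : ℝ) (ht : t ∈ Icc (0:ℝ) T) => K.locUnifC2 ht i
  have hJ : ∀ (i : Fin n) (t : ℝ), t ∈ Icc (0:ℝ) T → ∀ x ∈ posOrth n, ∀ v : Fin n → ℝ, v ≠ 0 →
      0 ≤ ∫ z in Icc (0:ℝ) 1, K.φ x t z i * dir2 (fun y => K.φ y t z i) x v :=
    fun i t ht x hx v hv =>
      K.integral_mul_dir2_nonneg ht (hlampos t ht) hx (hB x hx t ht) (hfin x hx t ht) i hv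
  have hD' : ∀ (i : Fin n) (t : ℝ), t ∈ Icc (0:ℝ) T → ∀ x ∈ posOrth n, ∀ z ∈ Icc (0:ℝ) 1,
      K.φ x t z i ^ 2 ≤ D * x i ^ 2 := fun i t ht x hx z hz => hD x hx t ht z hz i
  have hdep : ∀ t ∈ Icc (0:ℝ) T, Dk.RowDep t := hβdep
  have hconst : ∀ (i : Fin n) (t : ℝ), t ∈ Icc (0:ℝ) T → ∀ x ∈ posOrth n,
      ∀ s ∈ Ioi (0:ℝ), ∀ s' ∈ Ioi (0:ℝ),
      (∑ m, Dk.coef t i m s ^ 2) / s ^ 2 = (∑ m, Dk.coef t i m s' ^ 2) / s' ^ 2 ∧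
      (∫ z in Icc (0:ℝ) 1, K.φ (Function.update x i s) t z i ^ 2) / s ^ 2
        = (∫ z in Icc (0:ℝ) 1, K.φ (Function.update x i s') t z i ^ 2) / s' ^ 2 := by
    intro i t ht x hx
    have : Nontrivial (Fin n) := Fin.nontrivial_iff_two_le.2 hn
    obtain ⟨j, hji⟩ := exists_ne i
    have hP := (hdep t ht).monotoneOn_sum_sq_coef ht (fun x hx => hA x hx t ht) hji.symm
    have hR := monotoneOn_relMoment_update (hloc i t ht) (hJ i t ht) (hD' i t ht) hx
    have hl : 0 < lam t ^ 2 := by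
      have := hlampos t ht
      positivity
    have hvol' := hvol i t ht x hx _ rfl
    have hg : ∀ s ∈ Ioi (0:ℝ), (∑ j, (Dk.β (Function.update x i s) t i j) ^ 2
        + (lam t) ^ 2 * ∫ z in Icc (0:ℝ) 1, (K.φ (Function.update x i s) t z i) ^ 2) / s ^ 2
        = (∑ m, Dk.coef t i m s ^ 2) / s ^ 2 + lam t ^ 2 *
          ((∫ z in Icc (0:ℝ) 1, K.φ (Function.update x i s) t z i ^ 2) / s ^ 2) := fun s hs => by
      simp only [(hdep t ht).eq_coef (update_mem_posOrth hx i hs), Function.update_self]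
      ring
    have hnn : ∀ s : ℝ, 0 ≤ (∑ j, (Dk.β (Function.update x i s) t i j) ^ 2
        + (lam t) ^ 2 * ∫ z in Icc (0:ℝ) 1, (K.φ (Function.update x i s) t z i) ^ 2) / s ^ 2 :=
      fun s => by
        have : 0 ≤ ∫ z in Icc (0:ℝ) 1, (K.φ (Function.update x i s) t z i) ^ 2 :=
          integral_nonneg fun _ => sq_nonneg _
        positivity
    have hmono := hvol' fun s hs s' hs' hss' => Real.sqrt_le_sqrt (by
      rw [hg s hs, hg s' hs']
      exact add_le_add (hP hs hs' hss') (mul_le_mul_of_nonneg_left (hR hs hs' hss') hl.le))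
    intro s hs s' hs'
    refine hP.eq_of_add_mul_eq hR hl (fun r hr r' hr' => ?_) hs hs'
    rw [← hg r hr, ← hg r' hr']
    exact (Real.sqrt_inj (hnn r) (hnn r')).1 (hmono r hr r' hr')
  refine ⟨fun i j t => Dk.coef t i j 1, fun i t z => K.φ (fun _ => 1) t z i,
    fun t ht x hx i m => ?_, fun i t ht x hx => ?_⟩
  · have h := (hdep t ht).coef_div_eq ht (fun x hx => hA x hx t ht) (hx i) one_pos
      (hconst i t ht x hx _ (hx i) 1 (mem_Ioi.2 one_pos)).1 m
    rw [div_one, div_eq_iff (hx i).ne'] at h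
    rw [(hdep t ht).eq_coef hx, h, mul_comm]
  · have hray : ∀ x ∈ posOrth n, ∀ s, 0 < s →
        (∫ z in Icc (0:ℝ) 1, K.φ (Function.update x i s) t z i ^ 2) / s ^ 2
          = (∫ z in Icc (0:ℝ) 1, K.φ x t z i ^ 2) / x i ^ 2 := fun x hx s hs => by
      have := (hconst i t ht x hx s hs (x i) (hx i)).2
      rwa [Function.update_eq_self] at this
    have hle := fun (x y : Fin n → ℝ) (hx : x ∈ posOrth n) (hy : y ∈ posOrth n) =>
      (hloc i t ht).relMoment_le (hJ i t ht) (hD' i t ht) hray hx hy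
    have hc : ∀ x ∈ posOrth n, ∫ z in Icc (0:ℝ) 1, K.φ x t z i ^ 2
        = (∫ z in Icc (0:ℝ) 1, K.φ (fun _ => 1) t z i ^ 2) * x i ^ 2 := fun x hx => by
      have := le_antisymm (hle x _ hx hone) (hle _ x hone hx)
      rwa [one_pow, div_one, div_eq_iff (pow_ne_zero 2 (hx i).ne')] at this
    filter_upwards [(hloc i t ht).ae_eq_of_sq_integral_eq (hJ i t ht) hc hone hx] with z hz
    rw [div_one, div_eq_iff (hx i).ne'] at hz
    rw [hz, mul_comm]

end
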